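/- arXiv:0907.3855 — 8 statements merged into one kernel-verified Lean document; each statement's English description precedes it below -/
import Mathlib

section
/- Let p be a prime and R a commutative ring of characteristic p. On the set of sequences ℕ → R, define addition componentwise and multiplication by (a·b)_n = Σ_{i+j=n} (a_i)^{p^j} · (b_j)^{p^i}. Then these operations make ℕ → R into a commutative ring, whose zero element is the zero sequence and whose multiplicative identity is the sequence (1,0,0,…). (This ring is the ring of Frobenius-twisted power series R[[z]]^F.) -/
theorem ftps_assoc (p : ℕ) (hp : p.Prime) (R : Type*) [CommRing R] [CharP R p]
    (a b c : ℕ → R) (n : ℕ) :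
    ∑ x ∈ Finset.HasAntidiagonal.antidiagonal n,
      (∑ y ∈ Finset.HasAntidiagonal.antidiagonal x.1, a y.1 ^ p ^ y.2 * b y.2 ^ p ^ y.1) ^ p ^ x.2
        * c x.2 ^ p ^ x.1 =
    ∑ x ∈ Finset.HasAntidiagonal.antidiagonal n, a x.1 ^ p ^ x.2 *
      (∑ y ∈ Finset.HasAntidiagonal.antidiagonal x.2, b y.1 ^ p ^ y.2 * c y.2 ^ p ^ y.1) ^ p ^ x.1 := by
  have : Fact p.Prime := ⟨hp⟩
  simp only [sum_pow_char_pow p, Finset.sum_mul, Finset.mul_sum, Finset.sum_sigma']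
  refine Finset.sum_nbij' (fun x => ⟨(x.2.1, x.2.2 + x.1.2), (x.2.2, x.1.2)⟩)
    (fun x => ⟨(x.1.1 + x.2.1, x.2.2), (x.1.1, x.2.1)⟩) ?_ ?_ ?_ ?_ ?_
  · rintro ⟨⟨m, k⟩, ⟨i, j⟩⟩ h
    simp at h ⊢
    omega
  · rintro ⟨⟨m, k⟩, ⟨i, j⟩⟩ h
    simp at h ⊢
    omega
  · rintro ⟨⟨m, k⟩, ⟨i, j⟩⟩ h
    simp at h
    obtain ⟨h1, rfl⟩ := h
    rfl
  · rintro ⟨⟨m, k⟩, ⟨i, j⟩⟩ h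
    simp at h
    obtain ⟨h1, rfl⟩ := h
    rfl
  · rintro ⟨⟨m, k⟩, ⟨i, j⟩⟩ h
    simp at h
    obtain ⟨h1, rfl⟩ := h
    simp only [mul_pow, ← pow_mul, ← pow_add]
    rw [add_comm j i, add_comm k i, mul_assoc]

theorem ftps_comm (p : ℕ) (R : Type*) [CommRing R] (a b : ℕ → R) (n : ℕ) :
    ∑ x ∈ Finset.HasAntidiagonal.antidiagonal n, a x.1 ^ p ^ x.2 * b x.2 ^ p ^ x.1 =
    ∑ x ∈ Finset.HasAntidiagonal.antidiagonal n, b x.1 ^ p ^ x.2 * a x.2 ^ p ^ x.1 := by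
  rw [← Finset.Nat.sum_antidiagonal_swap]
  exact Finset.sum_congr rfl fun x _ => mul_comm _ _

theorem ftps_one (p : ℕ) (hp : p.Prime) (R : Type*) [CommRing R] (b : ℕ → R) (n : ℕ) :
    ∑ x ∈ Finset.HasAntidiagonal.antidiagonal n, (if x.1 = 0 then (1 : R) else 0) ^ p ^ x.2 * b x.2 ^ p ^ x.1
      = b n := by
  rw [Finset.sum_eq_single (0, n)]
  · simp
  · rintro ⟨i, j⟩ h hne
    have hi : i ≠ 0 := by
      rintro rfl
      simp at h
      exact hne (by rw [h])
    simp [hi, hp.ne_zero]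
  · simp

theorem ftps_add (p : ℕ) (hp : p.Prime) (R : Type*) [CommRing R] [CharP R p]
    (a b c : ℕ → R) (n : ℕ) :
    ∑ x ∈ Finset.HasAntidiagonal.antidiagonal n, a x.1 ^ p ^ x.2 * (b x.2 + c x.2) ^ p ^ x.1 =
    ∑ x ∈ Finset.HasAntidiagonal.antidiagonal n, a x.1 ^ p ^ x.2 * b x.2 ^ p ^ x.1 +
    ∑ x ∈ Finset.HasAntidiagonal.antidiagonal n, a x.1 ^ p ^ x.2 * c x.2 ^ p ^ x.1 := by
  have : Fact p.Prime := ⟨hp⟩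
  rw [← Finset.sum_add_distrib]
  exact Finset.sum_congr rfl fun x _ => by rw [add_pow_char_pow, mul_add]

theorem ftps_zero (p : ℕ) (hp : p.Prime) (R : Type*) [CommRing R] (a : ℕ → R) (n : ℕ) :
    ∑ x ∈ Finset.HasAntidiagonal.antidiagonal n, a x.1 ^ p ^ x.2 * (0 : R) ^ p ^ x.1 = 0 := by
  refine Finset.sum_eq_zero fun x _ => ?_
  rw [zero_pow (pow_ne_zero _ hp.ne_zero), mul_zero]

/-- Type synonym for sequences, hiding the pointwise ring structure. -/
def FTPS (R : Type*) := ℕ → R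

/-- The twisted ring structure. -/
@[reducible]
def ftpsCommRing (p : ℕ) (hp : p.Prime) (R : Type*) [CommRing R] [CharP R p] :
    CommRing (FTPS R) :=
  { (inferInstanceAs (AddCommGroup (ℕ → R)) : AddCommGroup (FTPS R)) with
    mul := fun a b n => ∑ ij ∈ Finset.HasAntidiagonal.antidiagonal n, a ij.1 ^ p ^ ij.2 * b ij.2 ^ p ^ ij.1
    one := fun n => if n = 0 then (1 : R) else 0
    mul_assoc := fun a b c => funext fun n => ftps_assoc p hp R a b c n
    mul_comm := fun a b => funext fun n => ftps_comm p R a b n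
    one_mul := fun b => funext fun n => ftps_one p hp R b n
    mul_one := fun b => funext fun n => (ftps_comm p R _ _ n).trans (ftps_one p hp R b n)
    left_distrib := fun a b c => funext fun n => ftps_add p hp R a b c n
    right_distrib := fun a b c => funext fun n => (ftps_comm p R _ c n).trans
      ((ftps_add p hp R c a b n).trans
        (congrArg₂ (· + ·) (ftps_comm p R c a n) (ftps_comm p R c b n)))
    mul_zero := fun a => funext fun n => ftps_zero p hp R a n
    zero_mul := fun a => funext fun n =>
      (ftps_comm p R _ a n).trans (ftps_zero p hp R a n) }

/-- The ring of Frobenius-twisted power series: the set of sequences `ℕ → R` carries a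
commutative ring structure with componentwise addition and the Frobenius-twisted
multiplication `(a·b)_n = ∑_{i+j=n} a_i^{p^j} · b_j^{p^i}`, with zero the zero sequence and
one the sequence `(1,0,0,…)`. -/
theorem frobeniusTwistedPowerSeries_commRing
    (p : ℕ) (hp : p.Prime) (R : Type*) [CommRing R] [CharP R p] :
    ∃ S : CommRing (ℕ → R),
      (∀ a b : ℕ → R, S.add a b = fun n => a n + b n) ∧
      (∀ a b : ℕ → R, S.mul a b =
        fun n => ∑ ij ∈ Finset.HasAntidiagonal.antidiagonal n, a ij.1 ^ p ^ ij.2 * b ij.2 ^ p ^ ij.1) ∧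
      (S.zero = fun _ => (0 : R)) ∧
      (S.one = fun n => if n = 0 then (1 : R) else 0) := by
  refine ⟨ftpsCommRing p hp R,
    fun _ _ => rfl, fun _ _ => rfl, rfl, rfl⟩
end

section
/- Let p be a prime, R a commutative ring of characteristic p, and let a, b be p-typical Witt vectors over R. Suppose i, j ∈ ℕ are such that the Witt coordinates satisfy a.coeff l = 0 for all l < i and b.coeff l = 0 for all l < j. Then (a·b).coeff l = 0 for all l < i + j, and (a·b).coeff (i+j) = (a.coeff i)^{p^j} · (b.coeff j)^{p^i}. (Hence the associated graded ring of the ring of Witt vectors W(R) along the filtration by the ideals I_n = {a : a.coeff l = 0 for l < n} carries the Frobenius-twisted multiplication.) -/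
theorem witt_eq_iter_aux (p : ℕ) [Fact p.Prime] (R : Type*) [CommRing R]
    (a : WittVector p R) (i : ℕ) (ha : ∀ l < i, a.coeff l = 0) :
    a = WittVector.verschiebung^[i] (WittVector.mk p fun n => a.coeff (n + i)) := by
  ext n
  rcases lt_or_ge n i with h | h
  · rw [ha n h, WittVector.iterate_verschiebung_coeff_eq_zero _ h]
  · obtain ⟨k, rfl⟩ := Nat.exists_eq_add_of_le' h
    rw [WittVector.iterate_verschiebung_coeff, WittVector.coeff_mk]

/-- For `p`-typical Witt vectors over a commutative ring of characteristic `p`: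
if the first `i` Witt coordinates of `a` and the first `j` Witt coordinates of `b` vanish,
then the first `i + j` coordinates of `a * b` vanish, and the `(i+j)`-th coordinate is
`(a.coeff i)^(p^j) * (b.coeff j)^(p^i)`. Hence the associated graded ring of `W(R)` along the
filtration by the ideals `Iₙ = {a | a.coeff l = 0 for l < n}` carries the Frobenius-twisted
multiplication. -/
theorem wittVector_mul_coeff_of_vanishing_below
    (p : ℕ) [Fact p.Prime] (R : Type*) [CommRing R] [CharP R p]
    (a b : WittVector p R) (i j : ℕ)
    (ha : ∀ l < i, a.coeff l = 0) (hb : ∀ l < j, b.coeff l = 0) :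
    (∀ l < i + j, (a * b).coeff l = 0) ∧
      (a * b).coeff (i + j) = a.coeff i ^ p ^ j * b.coeff j ^ p ^ i := by
  have h1 := witt_eq_iter_aux p R a i ha
  have h2 := witt_eq_iter_aux p R b j hb
  have e : a * b = _ := congrArg₂ (· * ·) h1 h2
  constructor
  · intro l hl
    rw [e]
    rw [WittVector.iterate_verschiebung_mul, WittVector.iterate_verschiebung_coeff_eq_zero _ hl]
  · rw [e]
    rw [WittVector.iterate_verschiebung_mul_coeff]
    simp only [WittVector.coeff_mk, zero_add]
end

section
/- Let p be a prime and R a commutative ring of characteristic p. The map 𝓕 from the formal power series ring R[[z]] to the ring of Frobenius-twisted power series R[[z]]^F, sending a power series with coefficient sequence (a_n)_{n∈ℕ} to the sequence (a_n^{p^n})_{n∈ℕ}, is a ring homomorphism. -/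
/-- The Frobenius-twisted multiplication on sequences `ℕ → R`:
`(a·b)_n = ∑_{i+j=n} a_i^{p^j} · b_j^{p^i}`. -/
def twistedMul (p : ℕ) {R : Type*} [CommRing R] (a b : ℕ → R) : ℕ → R :=
  fun n => ∑ ij ∈ Finset.HasAntidiagonal.antidiagonal n, a ij.1 ^ p ^ ij.2 * b ij.2 ^ p ^ ij.1

/-- The multiplicative unit `(1,0,0,…)` of the ring of Frobenius-twisted power series. -/
def twistedOne {R : Type*} [CommRing R] : ℕ → R := fun n => if n = 0 then 1 else 0

/-- The map `𝓕 : R[[z]] → R[[z]]^F`, sending a power series with coefficients `(a_n)` to the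
sequence `(a_n^{p^n})`. -/
noncomputable def frobTwist (p : ℕ) {R : Type*} [CommRing R] (a : PowerSeries R) : ℕ → R :=
  fun n => (PowerSeries.coeff n a) ^ p ^ n

/-- The map `𝓕 : R[[z]] → R[[z]]^F`, `(a_n) ↦ (a_n^{p^n})`, is a ring homomorphism from the
formal power series ring to the ring of Frobenius-twisted power series: it sends `1` to the
twisted one, `0` to `0`, sums to componentwise sums and products to twisted products. -/
theorem frobTwist_ringHom (p : ℕ) (hp : p.Prime) (R : Type*) [CommRing R] [CharP R p] :
    frobTwist p (1 : PowerSeries R) = twistedOne ∧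
    frobTwist p (0 : PowerSeries R) = (fun _ => (0 : R)) ∧
    (∀ a b : PowerSeries R,
      frobTwist p (a + b) = fun n => frobTwist p a n + frobTwist p b n) ∧
    (∀ a b : PowerSeries R,
      frobTwist p (a * b) = twistedMul p (frobTwist p a) (frobTwist p b)) := by
  have : Fact p.Prime := ⟨hp⟩
  have hp0 : ∀ n, p ^ n ≠ 0 := fun n => pow_ne_zero n hp.ne_zero
  refine ⟨?_, ?_, ?_, ?_⟩
  · funext n
    by_cases h : n = 0
    · simp [frobTwist, twistedOne, h]
    · simp [frobTwist, twistedOne, PowerSeries.coeff_one, h, hp.ne_zero]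
  · funext n
    simp [frobTwist, hp.ne_zero]
  · intro a b
    funext n
    simp only [frobTwist, map_add]
    exact add_pow_char_pow ..
  · intro a b
    funext n
    simp only [frobTwist, twistedMul, PowerSeries.coeff_mul]
    rw [sum_pow_char_pow]
    refine Finset.sum_congr rfl fun ij hij => ?_
    rw [Finset.HasAntidiagonal.mem_antidiagonal] at hij
    rw [mul_pow, ← pow_mul, ← pow_mul, ← pow_add, ← pow_add, add_comm ij.2 ij.1, hij]
end

section
/- Let p be a prime, R a commutative ring of characteristic p, and N ≥ 1 a natural number. In the ring of Frobenius-twisted power series R[[z]]^F, let z denote the sequence that is 1 in position 1 and 0 elsewhere. Then the principal ideal generated by z^N equals the ideal {a : a_l = 0 for all l < N} of all sequences whose first N coefficients vanish if and only if the Frobenius endomorphism x ↦ x^p of R is surjective. -/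
/-- The element `z` of the ring of Frobenius-twisted power series: the sequence which is `1` in
position `1` and `0` elsewhere. -/
def twistedZ {R : Type*} [CommRing R] : ℕ → R := fun n => if n = 1 then 1 else 0

/-- Powers with respect to the Frobenius-twisted multiplication. -/
def twistedPow (p : ℕ) {R : Type*} [CommRing R] (a : ℕ → R) : ℕ → (ℕ → R)
  | 0 => twistedOne
  | (N + 1) => twistedMul p a (twistedPow p a N)

theorem aux_mul (p : ℕ) (hp : p.Prime) {R : Type*} [CommRing R] (N : ℕ) (b : ℕ → R) (n : ℕ) :
    twistedMul p (fun n => if n = N then (1 : R) else 0) b n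
      = if N ≤ n then b (n - N) ^ p ^ N else 0 := by
  have hz : ∀ j, p ^ j ≠ 0 := fun j => pow_ne_zero _ hp.ne_zero
  unfold twistedMul
  split_ifs with h
  · rw [Finset.sum_eq_single (N, n - N)]
    · simp
    · rintro ⟨i, j⟩ hij hne
      rw [Finset.HasAntidiagonal.mem_antidiagonal] at hij
      have : i ≠ N := by
        rintro rfl
        apply hne
        simp only at hij
        ext <;> simp
        omega
      simp [this, zero_pow (hz j)]
    · intro hh
      exact absurd (by rw [Finset.HasAntidiagonal.mem_antidiagonal]; simp only; omega) hh
  · apply Finset.sum_eq_zero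
    rintro ⟨i, j⟩ hij
    rw [Finset.HasAntidiagonal.mem_antidiagonal] at hij
    have : i ≠ N := by
      simp only at hij
      omega
    simp [this, zero_pow (hz j)]

theorem aux_pow (p : ℕ) (hp : p.Prime) {R : Type*} [CommRing R] (N : ℕ) :
    twistedPow p (twistedZ : ℕ → R) N = fun n => if n = N then (1 : R) else 0 := by
  induction N with
  | zero => rfl
  | succ k ih =>
    funext n
    have h0 : p ≠ 0 := hp.ne_zero
    rw [twistedPow, ih]
    have := aux_mul p hp 1 (fun n => if n = k then (1 : R) else 0) n
    unfold twistedZ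
    rw [this]
    by_cases h : n = k + 1
    · subst h
      simp
    · by_cases h1 : 1 ≤ n
      · have h2 : n - 1 ≠ k := by omega
        simp [h, h2, h0]
      · simp [h, h1]

/-- In the ring of Frobenius-twisted power series `R[[z]]^F` over a commutative ring `R` of
characteristic `p`, for `N ≥ 1` the principal ideal generated by `z^N` (i.e. the set of twisted
multiples of `z^N`) equals the ideal of all sequences whose first `N` coefficients vanish if
and only if the Frobenius endomorphism `x ↦ x^p` of `R` is surjective. -/
theorem twisted_zPow_ideal_eq_iff_frobenius_surjective
    (p : ℕ) (hp : p.Prime) (R : Type*) [CommRing R] [CharP R p] (N : ℕ) (hN : 1 ≤ N) :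
    {a : ℕ → R | ∃ b : ℕ → R, a = twistedMul p (twistedPow p twistedZ N) b}
        = {a : ℕ → R | ∀ l < N, a l = 0}
      ↔ Function.Surjective fun x : R => x ^ p := by
  rw [aux_pow p hp]
  constructor
  · intro h x
    have hx : (fun n => if n = N then x else 0) ∈ {a : ℕ → R | ∀ l < N, a l = 0} := by
      intro l hl
      simp [hl.ne]
    rw [← h] at hx
    obtain ⟨b, hb⟩ := hx
    have := congrFun hb N
    rw [aux_mul p hp] at this
    simp only [if_true, le_refl, Nat.sub_self] at this
    refine ⟨b 0 ^ p ^ (N - 1), ?_⟩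
    simp only
    rw [this, ← pow_mul, ← pow_succ, Nat.sub_add_cancel hN]
  · intro h
    have hs : ∀ k (x : R), ∃ y : R, y ^ p ^ k = x := by
      intro k
      induction k with
      | zero => intro x; exact ⟨x, by simp⟩
      | succ k ih =>
        intro x
        obtain ⟨y, hy⟩ := h x
        obtain ⟨w, hw⟩ := ih y
        refine ⟨w, ?_⟩
        rw [pow_succ, pow_mul, hw]
        exact hy
    ext a
    constructor
    · rintro ⟨b, rfl⟩ l hl
      rw [aux_mul p hp, if_neg (by omega)]
    · intro ha
      choose f hf using hs N
      refine ⟨fun n => f (a (n + N)), ?_⟩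
      funext n
      rw [aux_mul p hp]
      split_ifs with hn
      · rw [hf, Nat.sub_add_cancel hn]
      · exact ha n (by omega)
end

section
/- Let p be a prime, R a commutative ring of characteristic p, and R[𝔛] the graded polynomial ring in variables x_1,…,x_m with deg x_i = p^{d_i}. Let I ⊆ R[𝔛] be the ideal generated by twisted-linear elements f_1,…,f_r with f_j ∈ FPV_{e_j}(R) for each j, and assume that R[𝔛]/I is flat as an R-module. Then for every N ∈ ℕ, the R-submodule Σ_{j : e_j ≤ N} R·(f_j)^{p^{N−e_j}} of R[𝔛] equals FPV_N(R) ∩ I. (Note that (f_j)^{p^{N−e_j}} ∈ FPV_N(R) since R has characteristic p.) -/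
open MvPolynomial

/-- `FPV p R mv d l` is the `R`-submodule of the polynomial ring `R[x_1,…,x_mv]`
(graded by `deg x_i = p^{d i}`) spanned by the twisted-linear monomials
`x_i ^ p^(l - d i)` for those `i` with `d i ≤ l`; each such monomial is homogeneous of
degree `p^l`. -/
noncomputable def FPV (p : ℕ) (R : Type*) [CommRing R] (mv : ℕ) (d : Fin mv → ℕ) (l : ℕ) :
    Submodule R (MvPolynomial (Fin mv) R) :=
  Submodule.span R {f | ∃ i : Fin mv, d i ≤ l ∧ f = X i ^ p ^ (l - d i)}


theorem FPV_pow {p : ℕ} (hp : p.Prime) {R : Type*} [CommRing R] [CharP R p]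
    {mv : ℕ} {d : Fin mv → ℕ} {l : ℕ} {h : MvPolynomial (Fin mv) R} (hh : h ∈ FPV p R mv d l)
    (s : ℕ) : h ^ p ^ s ∈ FPV p R mv d (l + s) := by
  have : Fact p.Prime := ⟨hp⟩
  unfold FPV at hh
  induction hh using Submodule.span_induction with
  | mem x hx =>
    obtain ⟨i, hi, rfl⟩ := hx
    refine Submodule.subset_span ⟨i, by omega, ?_⟩
    rw [← pow_mul, ← pow_add]
    congr 2
    omega
  | zero =>
    rw [zero_pow (pow_ne_zero _ hp.ne_zero)]
    exact Submodule.zero_mem _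
  | add x y _ _ hx hy =>
    rw [add_pow_char_pow]
    exact Submodule.add_mem _ hx hy
  | smul a x _ hx =>
    rw [smul_pow]
    exact Submodule.smul_mem _ _ hx

theorem FPV_map {p : ℕ} {R S : Type*} [CommRing R] [CommRing S] (σ : R →+* S)
    {mv : ℕ} {d : Fin mv → ℕ} {l : ℕ} {h : MvPolynomial (Fin mv) R} (hh : h ∈ FPV p R mv d l) :
    map σ h ∈ FPV p S mv d l := by
  unfold FPV at hh
  induction hh using Submodule.span_induction with
  | mem x hx =>
    obtain ⟨i, hi, rfl⟩ := hx
    refine Submodule.subset_span ⟨i, hi, by simp⟩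
  | zero => simp
  | add x y _ _ hx hy =>
    rw [map_add]
    exact Submodule.add_mem _ hx hy
  | smul a x _ hx =>
    rw [MvPolynomial.smul_eq_C_mul, map_mul, map_C, ← MvPolynomial.smul_eq_C_mul]
    exact Submodule.smul_mem _ _ hx

theorem FPV_field {p : ℕ} (hp : p.Prime) {K : Type*} [Field K] [CharP K p]
    {mv : ℕ} {d : Fin mv → ℕ} {r : ℕ}
    {f : Fin r → MvPolynomial (Fin mv) K} {e : Fin r → ℕ}
    (hf : ∀ j, f j ∈ FPV p K mv d (e j)) (N : ℕ)
    {g : MvPolynomial (Fin mv) K} (hg : g ∈ FPV p K mv d N)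
    (hgI : g ∈ Ideal.span (Set.range f)) :
    g ∈ Submodule.span K {g | ∃ j : Fin r, e j ≤ N ∧ g = f j ^ p ^ (N - e j)} := by
  by_contra hcon
  obtain ⟨φ, hφg, hφ⟩ := Submodule.exists_dual_map_eq_bot_of_notMem hcon inferInstance
  let L := AlgebraicClosure K
  have hroot : ∀ i : Fin mv, ∃ b : L, b ^ p ^ (N - d i) =
      algebraMap K L (φ (X i ^ p ^ (N - d i))) := fun i =>
    IsAlgClosed.exists_pow_nat_eq _ (pow_pos hp.pos _)
  choose b hb using hroot
  -- evaluation at b agrees with φ on FPV_N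
  have hev : ∀ h ∈ FPV p K mv d N, aeval b h = algebraMap K L (φ h) := by
    intro h hh
    unfold FPV at hh
    induction hh using Submodule.span_induction with
    | mem x hx =>
      obtain ⟨i, hi, rfl⟩ := hx
      simp [hb]
    | zero => simp
    | add x y _ _ hx hy => simp [hx, hy]
    | smul a x _ hx => rw [map_smul, map_smul, hx, smul_eq_mul, map_mul, Algebra.smul_def]
  let ψ : MvPolynomial (Fin mv) K →ₐ[K] Polynomial L :=
    aeval (fun i => Polynomial.C (b i) * Polynomial.X ^ p ^ d i)
  have hψ : ∀ l, ∀ h ∈ FPV p K mv d l, ψ h = Polynomial.C (aeval b h) * Polynomial.X ^ p ^ l := by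
    intro l h hh
    unfold FPV at hh
    induction hh using Submodule.span_induction with
    | mem x hx =>
      obtain ⟨i, hi, rfl⟩ := hx
      simp only [ψ, map_pow, aeval_X, mul_pow]
      rw [← pow_mul, ← pow_add]
      congr 3
      omega
    | zero => simp
    | add x y _ _ hx hy => simp [hx, hy, add_mul]
    | smul a x _ hx =>
      rw [map_smul, map_smul, hx, Algebra.smul_def, Algebra.smul_def, map_mul,
        Polynomial.algebraMap_apply, mul_assoc]
  have hle : Ideal.span (Set.range f) ≤
      (Ideal.span {(Polynomial.X : Polynomial L) ^ (p ^ N + 1)}).comap ψ := by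
    rw [Ideal.span_le]
    rintro _ ⟨j, rfl⟩
    rw [SetLike.mem_coe, Ideal.mem_comap, Ideal.mem_span_singleton, hψ _ _ (hf j)]
    by_cases hj : e j ≤ N
    · have h1 : aeval b (f j) = 0 := by
        have h2 : (aeval b (f j)) ^ p ^ (N - e j) = 0 := by
          rw [← map_pow, hev _ (by
            have := FPV_pow hp (hf j) (N - e j)
            rwa [Nat.add_sub_cancel' hj] at this)]
          have h3 : φ (f j ^ p ^ (N - e j)) ∈ Submodule.map φ
              (Submodule.span K {g | ∃ j : Fin r, e j ≤ N ∧ g = f j ^ p ^ (N - e j)}) :=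
            Submodule.mem_map_of_mem (Submodule.subset_span ⟨j, hj, rfl⟩)
          rw [hφ, Submodule.mem_bot] at h3
          rw [h3, map_zero]
        exact pow_eq_zero_iff (pow_ne_zero _ hp.ne_zero) |>.1 h2
      rw [h1]
      simp
    · refine Dvd.dvd.mul_left (pow_dvd_pow _ ?_) _
      exact Nat.pow_lt_pow_right hp.one_lt (by omega)
  have h4 := hle hgI
  rw [Ideal.mem_comap, Ideal.mem_span_singleton, hψ _ _ hg, hev _ hg,
    Polynomial.X_pow_dvd_iff] at h4
  have h5 := h4 (p ^ N) (by omega)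
  rw [Polynomial.coeff_C_mul_X_pow] at h5
  simp at h5
  exact hφg h5

theorem flat_indep {R : Type*} [CommRing R] (m : Ideal R) [hm : m.IsMaximal]
    {K : Type*} [Field K] (σ : R →+* K) (hσ : Function.Surjective σ) (hker : RingHom.ker σ = m)
    {A B : Type*} [AddCommGroup A] [Module R A] [Module.Flat R A] [AddCommGroup B] [Module K B]
    (ρ : A →ₛₗ[σ] B) {ι : Type*} [Fintype ι] (v : ι → A)
    (hv : LinearIndependent K (fun i => ρ (v i))) (c : ι → R) (hc : ∑ i, c i • v i = 0) :
    ∃ s, s ∉ m ∧ ∀ i, s * c i = 0 := by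
  classical
  obtain ⟨l, a, y, hay, hca⟩ := Module.Flat.isTrivialRelation_of_sum_smul_eq_zero hc
  let M : Matrix ι (Fin l) K := Matrix.of fun i j => σ (a i j)
  have hinj : LinearMap.ker M.vecMulLinear = ⊥ := by
    rw [LinearMap.ker_eq_bot']
    intro t ht
    have h1 : ∀ j, ∑ i, t i * σ (a i j) = 0 := fun j => by
      have := congrFun ht j
      simpa [Matrix.vecMul, dotProduct, M] using this
    have h2 : ∑ i, t i • ρ (v i) = 0 := by
      calc ∑ i, t i • ρ (v i) = ∑ i, ∑ j, (t i * σ (a i j)) • ρ (y j) := by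
            refine Finset.sum_congr rfl fun i _ => ?_
            rw [hay i, map_sum, Finset.smul_sum]
            refine Finset.sum_congr rfl fun j _ => ?_
            rw [LinearMap.map_smulₛₗ, smul_smul]
        _ = 0 := by
            rw [Finset.sum_comm]
            refine Finset.sum_eq_zero fun j _ => ?_
            rw [← Finset.sum_smul, h1, zero_smul]
    funext i
    exact Fintype.linearIndependent_iff.1 hv t h2 i
  obtain ⟨g, hg⟩ := LinearMap.exists_leftInverse_of_injective _ hinj
  have hsurj : Function.Surjective M.mulVec := by
    rw [Matrix.mulVec_surjective_iff_exists_right_inverse]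
    refine ⟨(LinearMap.toMatrix' g).transpose, ?_⟩
    ext i i'
    have h3 := congrFun (LinearMap.congr_fun hg (Pi.single i 1)) i'
    simp only [LinearMap.comp_apply, Matrix.vecMulLinear_apply, LinearMap.id_apply,
      Matrix.single_one_vecMul] at h3
    rw [← LinearMap.toMatrix'_mulVec] at h3
    rw [Matrix.mul_apply, Matrix.one_apply]
    simp only [Matrix.mulVec, dotProduct] at h3
    simp only [Matrix.transpose_apply]
    rw [Finset.sum_congr rfl fun j _ => mul_comm _ _]
    refine Eq.trans h3 ?_
    rw [Pi.single_apply]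
    simp only [eq_comm]
  obtain ⟨P, hP⟩ := Matrix.mulVec_surjective_iff_exists_right_inverse.1 hsurj
  choose τ hτ using hσ
  let a' : Matrix ι (Fin l) R := Matrix.of a
  let P' : Matrix (Fin l) ι R := Matrix.of fun j i => τ (P j i)
  have hdet : σ (a' * P').det = 1 := by
    rw [RingHom.map_det, RingHom.mapMatrix_apply, Matrix.map_mul]
    have e1 : a'.map σ = M := rfl
    have e2 : P'.map σ = P := by ext; simp [P', hτ]
    rw [e1, e2, hP, Matrix.det_one]
  refine ⟨(a' * P').det, ?_, ?_⟩
  · rw [← hker, RingHom.mem_ker, hdet]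
    exact one_ne_zero
  · have h5 : Matrix.vecMul c (a' * P') = 0 := by
      rw [← Matrix.vecMul_vecMul]
      have : Matrix.vecMul c a' = 0 := by
        funext j
        simpa [Matrix.vecMul, dotProduct, a'] using hca j
      rw [this, Matrix.zero_vecMul]
    have h6 : Matrix.vecMul c ((a' * P') * (a' * P').adjugate) = 0 := by
      rw [← Matrix.vecMul_vecMul, h5, Matrix.zero_vecMul]
    rw [Matrix.mul_adjugate] at h6
    intro i
    have := congrFun h6 i
    simpa [Matrix.vecMul_smul] using this

theorem span_lift {R K : Type*} [CommRing R] [Field K] (σ : R →+* K)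
    (hσ : Function.Surjective σ) {n : ℕ} (T : Set (MvPolynomial (Fin n) R))
    {x : MvPolynomial (Fin n) K} (hx : x ∈ Submodule.span K (map σ '' T)) :
    ∃ y ∈ Submodule.span R T, map σ y = x := by
  induction hx using Submodule.span_induction with
  | mem x hx =>
    obtain ⟨y, hy, rfl⟩ := hx
    exact ⟨y, Submodule.subset_span hy, rfl⟩
  | zero => exact ⟨0, Submodule.zero_mem _, map_zero _⟩
  | add x y _ _ hx hy =>
    obtain ⟨a, ha, rfl⟩ := hx
    obtain ⟨b, hb, rfl⟩ := hy
    exact ⟨a + b, Submodule.add_mem _ ha hb, map_add _ _ _⟩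
  | smul c x _ hx =>
    obtain ⟨a, ha, rfl⟩ := hx
    obtain ⟨c, rfl⟩ := hσ c
    refine ⟨c • a, Submodule.smul_mem _ _ ha, ?_⟩
    rw [MvPolynomial.smul_eq_C_mul, map_mul, map_C, ← MvPolynomial.smul_eq_C_mul]

theorem FPV_eq_range (p : ℕ) (R : Type*) [CommRing R] (mv : ℕ) (d : Fin mv → ℕ) (l : ℕ) :
    FPV p R mv d l = Submodule.span R (Set.range
      (fun i : {i : Fin mv // d i ≤ l} => (X i.1 : MvPolynomial (Fin mv) R) ^ p ^ (l - d i.1))) := by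
  unfold FPV
  congr 1
  ext h
  constructor
  · rintro ⟨i, hi, rfl⟩
    exact ⟨⟨i, hi⟩, rfl⟩
  · rintro ⟨i, rfl⟩
    exact ⟨i.1, i.2, rfl⟩

theorem FPV_mem_smul {p : ℕ} (hp : p.Prime) {R K : Type*} [CommRing R] [Field K] (σ : R →+* K)
    {m : Ideal R} (hker : RingHom.ker σ = m)
    {mv : ℕ} {d : Fin mv → ℕ} {l : ℕ} {w : MvPolynomial (Fin mv) R} (hw : w ∈ FPV p R mv d l)
    (hw0 : map σ w = 0) : w ∈ m • FPV p R mv d l := by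
  classical
  have hw' := hw
  rw [FPV_eq_range, Submodule.mem_span_range_iff_exists_fun] at hw'
  obtain ⟨c, rfl⟩ := hw'
  refine Submodule.sum_mem _ fun i _ => ?_
  refine Submodule.smul_mem_smul ?_ (Submodule.subset_span ⟨i.1, i.2, rfl⟩)
  rw [← hker, RingHom.mem_ker]
  have h1 := congrArg (coeff (Finsupp.single i.1 (p ^ (l - d i.1)))) hw0
  rw [coeff_map, coeff_sum, coeff_zero, Finset.sum_eq_single i] at h1
  · simpa [X_pow_eq_monomial] using h1
  · intro j _ hj
    rw [coeff_smul, X_pow_eq_monomial, coeff_monomial, if_neg, smul_zero]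
    intro hs
    rw [Finsupp.single_eq_single_iff] at hs
    rcases hs with hs | hs
    · exact hj (Subtype.ext hs.1)
    · exact pow_ne_zero _ hp.ne_zero hs.1
  · simp

theorem FPV_local {p : ℕ} (hp : p.Prime) {R K : Type*} [CommRing R] [CharP R p] [Field K]
    (σ : R →+* K) (hσ : Function.Surjective σ)
    (m : Ideal R) [hm : m.IsMaximal] (hker : RingHom.ker σ = m)
    {mv : ℕ} {d : Fin mv → ℕ} {r : ℕ}
    {f : Fin r → MvPolynomial (Fin mv) R} {e : Fin r → ℕ}
    (hf : ∀ j, f j ∈ FPV p R mv d (e j))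
    (hflat : Module.Flat R (MvPolynomial (Fin mv) R ⧸ Ideal.span (Set.range f)))
    (N : ℕ)
    (hle : Submodule.span R {g | ∃ j : Fin r, e j ≤ N ∧ g = f j ^ p ^ (N - e j)}
      ≤ FPV p R mv d N ⊓ (Ideal.span (Set.range f)).restrictScalars R)
    {g : MvPolynomial (Fin mv) R} (hg : g ∈ FPV p R mv d N)
    (hgI : g ∈ Ideal.span (Set.range f)) :
    ∃ s, s ∉ m ∧
      s • g ∈ Submodule.span R {g | ∃ j : Fin r, e j ≤ N ∧ g = f j ^ p ^ (N - e j)} := by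
  classical
  have hchar : CharP K p := by
    rw [CharP.charP_iff_prime_eq_zero hp, ← map_natCast σ, CharP.cast_eq_zero, map_zero]
  set G : Set (MvPolynomial (Fin mv) R) :=
    {g | ∃ j : Fin r, e j ≤ N ∧ g = f j ^ p ^ (N - e j)} with hG
  let f' : Fin r → MvPolynomial (Fin mv) K := fun j => map σ (f j)
  have hf' : ∀ j, f' j ∈ FPV p K mv d (e j) := fun j => FPV_map σ (hf j)
  let G' : Set (MvPolynomial (Fin mv) K) :=
    {g | ∃ j : Fin r, e j ≤ N ∧ g = f' j ^ p ^ (N - e j)}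
  have hGG : G' = map σ '' G := by
    ext x
    constructor
    · rintro ⟨j, hj, rfl⟩
      exact ⟨_, ⟨j, hj, rfl⟩, by simp [f']⟩
    · rintro ⟨_, ⟨j, hj, rfl⟩, rfl⟩
      exact ⟨j, hj, by simp [f']⟩
  let u : {i : Fin mv // d i ≤ N} → MvPolynomial (Fin mv) R := fun i => X i.1 ^ p ^ (N - d i.1)
  let u' : {i : Fin mv // d i ≤ N} → MvPolynomial (Fin mv) K := fun i => map σ (u i)
  have huF : ∀ i, u i ∈ FPV p R mv d N := fun i => Submodule.subset_span ⟨i.1, i.2, rfl⟩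
  have huF' : ∀ i, u' i ∈ FPV p K mv d N := fun i => FPV_map σ (huF i)
  obtain ⟨κ, a, ha, hspan, hli⟩ :=
    exists_linearIndependent' K (fun i => (Submodule.span K G').mkQ (u' i))
  have : Finite κ := Finite.of_injective a ha
  have : Fintype κ := Fintype.ofFinite κ
  -- Nakayama
  let V : Submodule R (MvPolynomial (Fin mv) R) := Submodule.span R (Set.range (u ∘ a))
  have hNak : FPV p R mv d N ≤ (Submodule.span R G ⊔ V) ⊔ m • FPV p R mv d N := by
    conv_lhs => rw [FPV_eq_range]
    rw [Submodule.span_le]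
    rintro _ ⟨i, rfl⟩
    change u i ∈ _
    have h1 : u' i ∈ Submodule.span K (map σ '' (G ∪ Set.range (u ∘ a))) := by
      have h2 : (Submodule.span K G').mkQ (u' i) ∈
          Submodule.span K (Set.range fun i => (Submodule.span K G').mkQ (u' i)) :=
        Submodule.subset_span ⟨i, rfl⟩
      rw [← hspan, Submodule.mem_span_range_iff_exists_fun] at h2
      obtain ⟨c, hc⟩ := h2
      have h3 : u' i - ∑ k, c k • u' (a k) ∈ Submodule.span K G' := by
        rw [← Submodule.ker_mkQ (Submodule.span K G'), LinearMap.mem_ker, map_sub, map_sum,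
          sub_eq_zero, ← hc]
        simp
      rw [Set.image_union, Submodule.span_union, ← hGG]
      rw [← sub_add_cancel (u' i) (∑ k, c k • u' (a k))]
      refine Submodule.add_mem_sup h3 (Submodule.sum_mem _ fun k _ => Submodule.smul_mem _ _
        (Submodule.subset_span ⟨_, ⟨k, rfl⟩, rfl⟩))
    obtain ⟨y, hy, hyu⟩ := span_lift σ hσ _ h1
    rw [Submodule.span_union] at hy
    have hyF : y ∈ FPV p R mv d N := by
      refine (sup_le (hle.trans inf_le_left) ?_ : Submodule.span R G ⊔ V ≤ FPV p R mv d N) hy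
      rw [Submodule.span_le]
      rintro _ ⟨k, rfl⟩
      exact huF _
    have h4 : u i - y ∈ m • FPV p R mv d N :=
      FPV_mem_smul hp σ hker (Submodule.sub_mem _ (huF i) hyF) (by rw [map_sub, hyu, sub_self])
    rw [← add_sub_cancel y (u i)]
    exact Submodule.add_mem_sup hy h4
  have hfg : (FPV p R mv d N).FG := by
    rw [FPV_eq_range]
    exact Submodule.fg_span (Set.finite_range _)
  obtain ⟨s, hs1, hs⟩ := Submodule.exists_sub_one_mem_and_smul_le_of_fg_of_le_sup hfg le_rfl hNak
  have hsm : s ∉ m := fun h => hm.ne_top ((Ideal.eq_top_iff_one _).2 (by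
    have := m.sub_mem h hs1
    simpa using this))
  have hsg : s • g ∈ Submodule.span R G ⊔ V := hs (Submodule.smul_mem_pointwise_smul _ _ _ hg)
  obtain ⟨x, hx, v, hv, hxv⟩ := Submodule.mem_sup.1 hsg
  obtain ⟨c, hc⟩ := (Submodule.mem_span_range_iff_exists_fun R).1 hv
  have hvI : v ∈ Ideal.span (Set.range f) := by
    have h1 : x ∈ Ideal.span (Set.range f) := (hle hx).2
    have h2 : s • g ∈ Ideal.span (Set.range f) := by
      rw [MvPolynomial.smul_eq_C_mul]
      exact Ideal.mul_mem_left _ _ hgI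
    rw [← hxv] at h2
    exact (Ideal.add_mem_iff_right _ h1).1 h2
  let I := Ideal.span (Set.range f)
  let I' := Ideal.span (Set.range f')
  have hII : I ≤ I'.comap (map σ) := by
    rw [Ideal.span_le]
    rintro _ ⟨j, rfl⟩
    exact Ideal.subset_span ⟨j, rfl⟩
  let ρ₀ : (MvPolynomial (Fin mv) R ⧸ I) →+* (MvPolynomial (Fin mv) K ⧸ I') :=
    Ideal.quotientMap I' (map σ) hII
  let ρ : (MvPolynomial (Fin mv) R ⧸ I) →ₛₗ[σ] (MvPolynomial (Fin mv) K ⧸ I') :=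
    { toFun := ρ₀
      map_add' := map_add ρ₀
      map_smul' := by
        intro b x
        obtain ⟨x, rfl⟩ := Ideal.Quotient.mk_surjective x
        change ρ₀ (Ideal.Quotient.mk I (b • x)) = Ideal.Quotient.mk I' (σ b • map σ x)
        rw [Ideal.quotientMap_mk, MvPolynomial.smul_eq_C_mul, map_mul, map_C,
          ← MvPolynomial.smul_eq_C_mul] }
  have hind : LinearIndependent K (fun k => ρ (Ideal.Quotient.mk I (u (a k)))) := by
    rw [Fintype.linearIndependent_iff]
    intro t ht
    have h1 : ∑ k, t k • u' (a k) ∈ I' := by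
      rw [← Ideal.Quotient.eq_zero_iff_mem, ← ht, map_sum]
      rfl
    have h2 := FPV_field hp hf' N
      (Submodule.sum_mem _ fun k _ => Submodule.smul_mem _ (t k) (huF' (a k))) h1
    refine Fintype.linearIndependent_iff.1 hli t ?_
    rw [← Submodule.ker_mkQ (Submodule.span K _), LinearMap.mem_ker, map_sum] at h2
    simpa using h2
  obtain ⟨s', hs'm, hs'⟩ := flat_indep m σ hσ hker ρ
    (fun k => (Ideal.Quotient.mk I (u (a k)))) hind c (by
      have h1 : Ideal.Quotient.mk I (∑ k, c k • u (a k)) = 0 := by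
        rw [Ideal.Quotient.eq_zero_iff_mem]
        have := hvI
        rw [← hc] at this
        exact this
      rw [← h1, map_sum]
      rfl)
  refine ⟨s' * s, fun h => ?_, ?_⟩
  · rcases hm.isPrime.mem_or_mem h with h | h
    · exact hs'm h
    · exact hsm h
  · have : s' • v = 0 := by
      rw [← hc, Finset.smul_sum]
      refine Finset.sum_eq_zero fun k _ => ?_
      rw [smul_smul, hs', zero_smul]
    rw [mul_smul, ← hxv, smul_add, this, add_zero]
    exact Submodule.smul_mem _ _ hx

/-- Let `I ⊆ R[𝔛]` be the ideal generated by twisted-linear elements `f_j ∈ FPV_{e_j}(R)`,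
and assume `R[𝔛]/I` is `R`-flat. Then for every `N`, the `R`-submodule
`∑_{j : e_j ≤ N} R · f_j^{p^{N-e_j}}` equals `FPV_N(R) ∩ I`. -/
theorem twistedLinear_span_eq_FPV_inter
    (p : ℕ) (hp : p.Prime) (R : Type*) [CommRing R] [CharP R p]
    (mv : ℕ) (d : Fin mv → ℕ) (r : ℕ)
    (f : Fin r → MvPolynomial (Fin mv) R) (e : Fin r → ℕ)
    (hf : ∀ j, f j ∈ FPV p R mv d (e j))
    (hflat : Module.Flat R (MvPolynomial (Fin mv) R ⧸ Ideal.span (Set.range f)))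
    (N : ℕ) :
    Submodule.span R {g | ∃ j : Fin r, e j ≤ N ∧ g = f j ^ p ^ (N - e j)}
      = FPV p R mv d N ⊓ (Ideal.span (Set.range f)).restrictScalars R := by
  have hle : Submodule.span R {g | ∃ j : Fin r, e j ≤ N ∧ g = f j ^ p ^ (N - e j)}
      ≤ FPV p R mv d N ⊓ (Ideal.span (Set.range f)).restrictScalars R := by
    rw [Submodule.span_le]
    rintro _ ⟨j, hj, rfl⟩
    refine ⟨?_, ?_⟩
    · have := FPV_pow hp (hf j) (N - e j)
      rwa [Nat.add_sub_cancel' hj] at this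
    · exact Ideal.pow_mem_of_mem _ (Ideal.subset_span (Set.mem_range_self j)) _ (pow_pos hp.pos _)
  refine le_antisymm hle ?_
  rintro g ⟨hg, hgI⟩
  by_contra hcon
  let J : Ideal R := Submodule.comap (LinearMap.toSpanSingleton R _ g)
    (Submodule.span R {g | ∃ j : Fin r, e j ≤ N ∧ g = f j ^ p ^ (N - e j)})
  have hJ : J ≠ ⊤ := by
    rw [Ideal.ne_top_iff_one]
    intro h
    apply hcon
    simpa [J] using h
  obtain ⟨m, hm, hJm⟩ := Ideal.exists_le_maximal J hJ
  letI : Field (R ⧸ m) := Ideal.Quotient.field m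
  obtain ⟨s, hs, hsg⟩ := FPV_local hp (Ideal.Quotient.mk m) Ideal.Quotient.mk_surjective m
    Ideal.mk_ker hf hflat N hle hg hgI
  exact hs (hJm (by simpa [J] using hsg))
end

section
/- Let p be a prime, R a commutative ring of characteristic p, and R[𝔛] the graded polynomial ring in variables x_1,…,x_m with deg x_i = p^{d_i}. Let I ⊆ R[𝔛] be a twisted-linear ideal such that R[𝔛]/I is flat as an R-module. Then for every N ∈ ℕ: (1) the quotient R-module FPV_N(R)/(FPV_N(R) ∩ I) is flat over R, and (2) the quotient R[𝔛]_{p^N}/(FPV_N(R) + I_{p^N}) is flat over R, where R[𝔛]_{p^N} and I_{p^N} denote the homogeneous components of degree p^N of R[𝔛] and of I, respectively. -/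
open MvPolynomial

lemma aux_functional {R Q : Type*} [CommRing R] [AddCommGroup Q] [Module R Q]
    (F : Submodule R Q) (P : Ideal R) [P.IsMaximal] (x : Q) (hx : x ∈ F) (hxP : x ∉ P • F) :
    ∃ L : F →ₗ[R] R ⧸ P, L ⟨x, hx⟩ ≠ 0 := by
  let _ := Ideal.Quotient.field P
  by_contra! hcon
  apply hxP
  have h1 : ∀ φ : Module.Dual (R ⧸ P) (F ⧸ (P • (⊤ : Submodule R F))),
      φ ((P • (⊤ : Submodule R F)).mkQ ⟨x, hx⟩) = 0 := fun φ =>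
    hcon ((φ.restrictScalars R) ∘ₗ (P • (⊤ : Submodule R F)).mkQ)
  rw [Module.forall_dual_apply_eq_zero_iff] at h1
  have h2 : (⟨x, hx⟩ : F) ∈ P • (⊤ : Submodule R F) := (Submodule.Quotient.mk_eq_zero _).1 h1
  have h3 : P • F = (P • (⊤ : Submodule R F)).map F.subtype := by
    rw [Submodule.map_smul'']; simp
  rw [h3]
  exact ⟨_, h2, rfl⟩

lemma FPV_pow_mem (p : ℕ) [hp : Fact p.Prime] (R : Type*) [CommRing R] [CharP R p]
    (mv : ℕ) (d : Fin mv → ℕ) (l N : ℕ) (hl : l ≤ N) (f : MvPolynomial (Fin mv) R)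
    (hf : f ∈ FPV p R mv d l) : f ^ p ^ (N - l) ∈ FPV p R mv d N := by
  induction hf using Submodule.span_induction with
  | mem x hx =>
    obtain ⟨i, hi, rfl⟩ := hx
    refine Submodule.subset_span ⟨i, hi.trans hl, ?_⟩
    rw [← pow_mul, ← pow_add]
    congr 2; omega
  | zero => rw [zero_pow (pow_pos hp.out.pos _).ne']; exact zero_mem _
  | add x y _ _ hx hy => rw [add_pow_char_pow]; exact add_mem hx hy
  | smul a x _ hx => rw [smul_pow]; exact Submodule.smul_mem _ _ hx

lemma aux_key (p : ℕ) [hp : Fact p.Prime] (R : Type*) [CommRing R] [CharP R p]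
    (mv : ℕ) (d : Fin mv → ℕ) (I : Ideal (MvPolynomial (Fin mv) R))
    (s : Set (MvPolynomial (Fin mv) R))
    (hs : ∀ f ∈ s, ∃ l : ℕ, f ∈ FPV p R mv d l) (hI : I = Ideal.span s) (N : ℕ)
    (P : Ideal R) [P.IsMaximal] (L : FPV p R mv d N →ₗ[R] R ⧸ P)
    (hL : ∀ f : FPV p R mv d N, (f : MvPolynomial (Fin mv) R) ∈ I → L f = 0)
    (y : FPV p R mv d N)
    (hy : Ideal.Quotient.mk I y ∈ P • (⊤ : Submodule R (MvPolynomial (Fin mv) R ⧸ I))) :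
    L y = 0 := by
  let _ := Ideal.Quotient.field P
  let K := AlgebraicClosure (R ⧸ P)
  have hcP : CharP (R ⧸ P) p := by
    have : ((p : ℕ) : R ⧸ P) = 0 := by
      have h := congrArg (Ideal.Quotient.mk P) (CharP.cast_eq_zero R p)
      rwa [map_natCast, map_zero] at h
    exact (CharP.charP_iff_prime_eq_zero hp.out).2 this
  have hcK : CharP K p := charP_of_injective_algebraMap (algebraMap (R ⧸ P) K).injective p
  let ι : R ⧸ P →+* K := algebraMap (R ⧸ P) K
  have hX : ∀ i, d i ≤ N → (X i ^ p ^ (N - d i) : MvPolynomial (Fin mv) R) ∈ FPV p R mv d N :=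
    fun i hi => Submodule.subset_span ⟨i, hi, rfl⟩
  have hc : ∀ i, ∃ c : K, ∀ hi : d i ≤ N, c ^ p ^ (N - d i) = ι (L ⟨_, hX i hi⟩) := by
    intro i
    by_cases hi : d i ≤ N
    · obtain ⟨c, hc⟩ := IsAlgClosed.exists_pow_nat_eq (ι (L ⟨_, hX i hi⟩))
        (pow_pos hp.out.pos (N - d i))
      exact ⟨c, fun _ => hc⟩
    · exact ⟨0, fun h => absurd h hi⟩
  choose c hc using hc
  let ρ : R →+* Polynomial K := Polynomial.C.comp (ι.comp (Ideal.Quotient.mk P))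
  let ev : MvPolynomial (Fin mv) R →+* Polynomial K :=
    eval₂Hom ρ (fun i => Polynomial.C (c i) * Polynomial.X ^ p ^ d i)
  have hevX : ∀ i l, d i ≤ l → ev (X i ^ p ^ (l - d i)) =
      Polynomial.C (c i ^ p ^ (l - d i)) * Polynomial.X ^ p ^ l := by
    intro i l hl
    simp only [ev, map_pow, coe_eval₂Hom, eval₂_X, mul_pow]
    rw [← pow_mul, ← pow_add]
    congr 3; omega
  have hevs : ∀ (a : R) f, ev (a • f) = Polynomial.C (ι (Ideal.Quotient.mk P a)) * ev f := by
    intro a f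
    rw [MvPolynomial.smul_eq_C_mul, map_mul]
    congr 1
    simp [ev, ρ]
  have main : ∀ l (hl : l ≤ N) f (hf : f ∈ FPV p R mv d l), ∃ e : K,
      ev f = Polynomial.C e * Polynomial.X ^ p ^ l ∧
      e ^ p ^ (N - l) = ι (L ⟨_, FPV_pow_mem p R mv d l N hl f hf⟩) := by
    intro l hl f hf
    induction hf using Submodule.span_induction with
    | mem x hx =>
      obtain ⟨i, hi, rfl⟩ := hx
      refine ⟨_, hevX i l hi, ?_⟩
      rw [← pow_mul, ← pow_add]
      have h1 : l - d i + (N - l) = N - d i := by omega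
      rw [h1, hc i (hi.trans hl)]
      congr 3
      rw [← pow_mul, ← pow_add, h1]
    | zero =>
      refine ⟨0, by simp, ?_⟩
      have h0 := (pow_pos hp.out.pos (N - l)).ne'
      rw [zero_pow h0, ← map_zero ι, ← map_zero L]
      congr 3
      exact Subtype.ext (zero_pow h0).symm
    | add x y hx' hy' hx hy =>
      obtain ⟨e, he, he'⟩ := hx
      obtain ⟨g, hg, hg'⟩ := hy
      refine ⟨e + g, by rw [map_add, he, hg, map_add, add_mul], ?_⟩
      rw [add_pow_char_pow, he', hg', ← map_add, ← map_add]
      congr 3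
      simp [add_pow_char_pow]
    | smul a x hx' hx =>
      obtain ⟨e, he, he'⟩ := hx
      refine ⟨ι (Ideal.Quotient.mk P a) * e, by rw [hevs, he, map_mul, mul_assoc], ?_⟩
      rw [mul_pow, he', ← map_pow, ← map_pow, ← map_mul]
      have : Ideal.Quotient.mk P (a ^ p ^ (N - l)) *
          L ⟨_, FPV_pow_mem p R mv d l N hl x hx'⟩ =
          a ^ p ^ (N - l) • L ⟨_, FPV_pow_mem p R mv d l N hl x hx'⟩ := rfl
      rw [this, ← map_smul]
      congr 3
      simp [smul_pow]
  have main2 : ∀ l, N < l → ∀ f ∈ FPV p R mv d l, Polynomial.X ^ (p ^ N + 1) ∣ ev f := by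
    intro l hl f hf
    induction hf using Submodule.span_induction with
    | mem x hx =>
      obtain ⟨i, hi, rfl⟩ := hx
      rw [hevX i l hi]
      exact Dvd.dvd.mul_left (pow_dvd_pow _ (Nat.pow_lt_pow_right hp.out.one_lt hl)) _
    | zero => simp
    | add x y _ _ hx hy => rw [map_add]; exact dvd_add hx hy
    | smul a x _ hx => rw [hevs]; exact hx.mul_left _
  let T : Ideal (Polynomial K) := Ideal.span {Polynomial.X ^ (p ^ N + 1)}
  have hIT : I ≤ T.comap ev := by
    rw [hI, Ideal.span_le]
    intro f hf
    obtain ⟨l, hl⟩ := hs f hf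
    show ev f ∈ T
    rw [Ideal.mem_span_singleton]
    rcases le_or_gt l N with hlN | hlN
    · obtain ⟨e, he, he'⟩ := main l hlN f hl
      rw [hL _ (by
        rw [hI]
        exact Ideal.pow_mem_of_mem _ (Ideal.subset_span hf) _ (pow_pos hp.out.pos _)), map_zero] at he'
      have : e = 0 := by
        exact (pow_eq_zero_iff (pow_pos hp.out.pos _).ne').1 he'
      rw [he, this]; simp
    · exact main2 l hlN f hl
  have hfin : ∀ z ∈ P • (⊤ : Submodule R (MvPolynomial (Fin mv) R ⧸ I)),
      Ideal.Quotient.lift I ((Ideal.Quotient.mk T).comp ev)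
        (fun a ha => Ideal.Quotient.eq_zero_iff_mem.2 (hIT ha)) z = 0 := by
    intro z hz
    induction hz using Submodule.smul_induction_on' with
    | smul r hr q hq =>
      obtain ⟨q, rfl⟩ := Ideal.Quotient.mk_surjective q
      have : r • (Ideal.Quotient.mk I q) = Ideal.Quotient.mk I (r • q) := rfl
      rw [this, Ideal.Quotient.lift_mk, RingHom.comp_apply, hevs,
        Ideal.Quotient.eq_zero_iff_mem.2 hr]
      simp
    | add x hx y hy h1 h2 => rw [map_add, h1, h2, add_zero]
  have h1 := hfin _ hy
  rw [Ideal.Quotient.lift_mk, RingHom.comp_apply, Ideal.Quotient.eq_zero_iff_mem,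
    Ideal.mem_span_singleton, Polynomial.X_pow_dvd_iff] at h1
  have h2 := h1 (p ^ N) (Nat.lt_succ_self _)
  obtain ⟨e, he, he'⟩ := main N le_rfl y y.2
  rw [he] at h2
  simp at h2
  rw [h2] at he'
  apply (algebraMap (R ⧸ P) K).injective
  rw [map_zero]
  simpa using he'.symm

theorem FPV_homog (p : ℕ) (R : Type*) [CommRing R]
    (mv : ℕ) (d : Fin mv → ℕ) (l : ℕ) :
    FPV p R mv d l ≤ weightedHomogeneousSubmodule R (fun i => p ^ d i) (p ^ l) := by
  rw [FPV, Submodule.span_le]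
  rintro _ ⟨i, hi, rfl⟩
  have := (isWeightedHomogeneous_X R (fun i => p ^ d i) i).pow (p ^ (l - d i))
  rw [smul_eq_mul, ← pow_add, Nat.sub_add_cancel hi] at this
  exact this
open TensorProduct

lemma aux_quot_flat {R Q : Type*} [CommRing R] [AddCommGroup Q] [Module R Q] [Module.Flat R Q]
    (F : Submodule R Q) (h : ∀ J : Ideal R, ∀ x ∈ F, x ∈ J • (⊤ : Submodule R Q) → x ∈ J • F) :
    Module.Flat R (Q ⧸ F) := by
  rw [Module.Flat.iff_lift_lsmul_comp_subtype_injective]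
  intro J _
  rw [injective_iff_map_eq_zero]
  intro z hz
  obtain ⟨w, rfl⟩ := LinearMap.lTensor_surjective J F.mkQ_surjective z
  have hQ := (Module.Flat.iff_lift_lsmul_comp_subtype_injective (R := R) (M := Q)).1 inferInstance
    (I := J) ‹_›
  set ψ : J ⊗[R] Q →ₗ[R] Q := TensorProduct.lift ((LinearMap.lsmul R Q).comp J.subtype) with hψ
  have hcomp : (TensorProduct.lift ((LinearMap.lsmul R (Q ⧸ F)).comp J.subtype)) ∘ₗ
      (LinearMap.lTensor J F.mkQ) = F.mkQ ∘ₗ ψ := by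
    ext; simp [ψ]
  have h1 : F.mkQ (ψ w) = 0 := by
    rw [← LinearMap.comp_apply, ← hcomp]; exact hz
  have h2 : ψ w ∈ F := by simpa using h1
  have h3 : ψ w ∈ J • (⊤ : Submodule R Q) := by
    clear hz h1 h2
    induction w with
    | zero => simp
    | tmul a b => exact Submodule.smul_mem_smul a.2 trivial
    | add a b ha hb => rw [map_add]; exact add_mem ha hb
  have h4 := h J _ h2 h3
  have h5 : ∀ x ∈ J • F, ∃ u : J ⊗[R] Q, ψ u = x ∧ LinearMap.lTensor J F.mkQ u = 0 := by
    intro x hx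
    induction hx using Submodule.smul_induction_on' with
    | smul r hr n hn =>
      refine ⟨⟨r, hr⟩ ⊗ₜ n, by simp [ψ], ?_⟩
      have : F.mkQ n = 0 := by simpa using hn
      rw [LinearMap.lTensor_tmul, this, TensorProduct.tmul_zero]
    | add x hx y hy h1 h2 =>
      obtain ⟨u, hu, hu'⟩ := h1
      obtain ⟨v, hv, hv'⟩ := h2
      exact ⟨u + v, by rw [map_add, hu, hv], by rw [map_add, hu', hv', add_zero]⟩
  obtain ⟨u, hu, hu'⟩ := h5 _ h4
  rw [← hQ hu, hu']

lemma aux_sub_flat {R Q : Type*} [CommRing R] [AddCommGroup Q] [Module R Q] [Module.Flat R Q]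
    (F : Submodule R Q) [Module.Flat R (Q ⧸ F)] : Module.Flat R F := by
  rw [Module.Flat.iff_rTensor_injective']
  intro J
  have h1 : Function.Injective (LinearMap.lTensor J F.subtype) :=
    LinearMap.lTensor_injective_of_exact_of_flat F.mkQ F.mkQ_surjective F.subtype
      F.injective_subtype (LinearMap.exact_subtype_mkQ F) J
  have h2 : Function.Injective (LinearMap.rTensor Q J.subtype) :=
    Module.Flat.rTensor_preserves_injective_linearMap _ J.injective_subtype
  have h3 : (LinearMap.lTensor R F.subtype) ∘ₗ (LinearMap.rTensor F J.subtype) =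
    (LinearMap.rTensor Q J.subtype) ∘ₗ (LinearMap.lTensor J F.subtype) := by
    ext; simp
  have h4 : Function.Injective ((LinearMap.lTensor R F.subtype) ∘ₗ (LinearMap.rTensor F J.subtype)) := by
    rw [h3]; exact h2.comp h1
  exact Function.Injective.of_comp (f := LinearMap.lTensor R F.subtype) h4

/-- a matrix whose rows are independent modulo a maximal ideal has a right inverse locally -/
lemma aux_matrix {R : Type*} [CommRing R] (P : Ideal R) [P.IsMaximal] {n k : ℕ}
    (b : Matrix (Fin n) (Fin k) R)
    (hb : ∀ c : Fin n → R, (∀ l, ∑ i, c i * b i l ∈ P) → ∀ i, c i ∈ P) :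
    ∃ c : Matrix (Fin k) (Fin n) R, (b * c).det ∉ P := by
  let _ := Ideal.Quotient.field P
  let π := Ideal.Quotient.mk P
  let B := b.map π
  have hinj : LinearMap.ker (Matrix.vecMulLinear B) = ⊥ := by
    rw [LinearMap.ker_eq_bot']
    intro v hv
    choose c hc using fun i => Ideal.Quotient.mk_surjective (I := P) (v i)
    have := hb c (fun l => by
      rw [← Ideal.Quotient.eq_zero_iff_mem]
      have := congrFun hv l
      simpa [Matrix.vecMul, dotProduct, B, π, ← hc] using this)
    ext i
    rw [← hc, Pi.zero_apply, Ideal.Quotient.eq_zero_iff_mem]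
    exact this i
  obtain ⟨g, hg⟩ := LinearMap.exists_leftInverse_of_injective _ hinj
  let C : Matrix (Fin k) (Fin n) (R ⧸ P) := Matrix.of fun l i => g (Pi.single l 1) i
  have hBC : B * C = 1 := by
    ext i j
    have h := congrFun (congrArg (fun f => f (Pi.single i 1)) hg) j
    have hs : ∀ v : Fin k → R ⧸ P, g v = ∑ l, v l • g (Pi.single l 1) := by
      intro v
      conv_lhs => rw [pi_eq_sum_univ' v]
      simp [map_sum]
    simp only [LinearMap.comp_apply, LinearMap.id_apply] at h
    rw [hs] at h
    simp [Matrix.one_apply, Finset.sum_apply, Pi.single_apply] at h ⊢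
    rw [Matrix.mul_apply]
    simp only [C, Matrix.of_apply]
    rw [h]
    simp [eq_comm]
  choose c hc using fun l i => Ideal.Quotient.mk_surjective (I := P) (C l i)
  refine ⟨Matrix.of c, fun hP => ?_⟩
  rw [← Ideal.Quotient.eq_zero_iff_mem, RingHom.map_det, RingHom.mapMatrix_apply, Matrix.map_mul] at hP
  have : (Matrix.map (Matrix.of c) (Ideal.Quotient.mk P)) = C := by ext l i; exact hc l i
  rw [this] at hP
  erw [hBC] at hP
  simp at hP

lemma aux_basis {R Q : Type*} [CommRing R] [AddCommGroup Q] [Module R Q]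
    (F : Submodule R Q) (hF : F.FG) (P : Ideal R) [P.IsMaximal] :
    ∃ (n : ℕ) (v : Fin n → Q), (∀ i, v i ∈ F) ∧ F ≤ Submodule.span R (Set.range v) ⊔ P • F ∧
      ∀ c : Fin n → R, ∑ i, c i • v i ∈ P • F → ∀ i, c i ∈ P := by
  let _ := Ideal.Quotient.field P
  have : Module.Finite R F := Module.Finite.iff_fg.2 hF
  let V := F ⧸ (P • (⊤ : Submodule R F))
  have : Module.Finite (R ⧸ P) V := Module.Finite.of_restrictScalars_finite R _ _
  let B := Module.finBasis (R ⧸ P) V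
  choose v hv using fun i => Submodule.mkQ_surjective (P • (⊤ : Submodule R F)) (B i)
  have hPF : ∀ x : F, (x : Q) ∈ P • F ↔ x ∈ P • (⊤ : Submodule R F) := by
    intro x
    have : P • F = (P • (⊤ : Submodule R F)).map F.subtype := by
      rw [Submodule.map_smul'']; simp
    rw [this]
    constructor
    · rintro ⟨z, hz, hzx⟩
      rwa [← F.injective_subtype hzx]
    · exact fun hx => ⟨x, hx, rfl⟩
  have hsm : ∀ (c : R) (x : V), Ideal.Quotient.mk P c • x = c • x := fun c x => rfl
  refine ⟨_, fun i => (v i : Q), fun i => (v i).2, ?_, ?_⟩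
  · intro x hx
    choose c hc using fun i => Ideal.Quotient.mk_surjective (I := P) (B.repr ((P • (⊤ : Submodule R F)).mkQ ⟨x, hx⟩) i)
    have h1 := B.sum_repr ((P • (⊤ : Submodule R F)).mkQ ⟨x, hx⟩)
    simp only [← hc, ← hv, hsm] at h1
    simp only [← map_smul, ← map_sum] at h1
    have h2 : (∑ i, c i • v i) - ⟨x, hx⟩ ∈ P • (⊤ : Submodule R F) := by
      rw [← Submodule.Quotient.eq]; exact h1
    rw [← hPF] at h2
    have h3 : x = ∑ i, c i • (v i : Q) + -(((∑ i, c i • v i) - ⟨x, hx⟩ : F) : Q) := by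
      simp
    rw [h3]
    refine Submodule.add_mem_sup (Submodule.sum_mem _ fun i _ => Submodule.smul_mem _ _ (Submodule.subset_span ⟨i, rfl⟩)) (neg_mem h2)
  · intro c hc i
    have h1 : (∑ i, c i • v i) ∈ P • (⊤ : Submodule R F) := by
      rw [← hPF]; simpa using hc
    have h2 : ∑ i, (Ideal.Quotient.mk P (c i)) • B i = 0 := by
      simp only [← hv, hsm, ← map_smul, ← map_sum]
      exact (Submodule.Quotient.mk_eq_zero _).2 h1
    have := (Fintype.linearIndependent_iff.1 B.linearIndependent) _ h2 i
    rwa [Ideal.Quotient.eq_zero_iff_mem] at this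

lemma aux_pure {R Q : Type*} [CommRing R] [AddCommGroup Q] [Module R Q] [Module.Flat R Q]
    (F : Submodule R Q) (hF : F.FG)
    (h : ∀ P : Ideal R, P.IsMaximal → ∀ x ∈ F, x ∈ P • (⊤ : Submodule R Q) → x ∈ P • F)
    (J : Ideal R) (x : Q) (hx : x ∈ F) (hxJ : x ∈ J • (⊤ : Submodule R Q)) : x ∈ J • F := by
  by_contra hcon
  let K : Ideal R := (J • F).comap (LinearMap.toSpanSingleton R Q x)
  have hK : K ≠ ⊤ := by
    rw [Ideal.ne_top_iff_one]
    intro h1; apply hcon; simpa [K] using h1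
  obtain ⟨P, hP, hKP⟩ := Ideal.exists_le_maximal K hK
  obtain ⟨n, v, hvF, hspan, hind⟩ := aux_basis F hF P
  obtain ⟨s, hs1, hs⟩ := Submodule.exists_sub_one_mem_and_smul_le_of_fg_of_le_sup hF le_rfl hspan
  have hsP : s ∉ P := fun hsP => hP.ne_top ((Ideal.eq_top_iff_one _).2 (by
    have := P.sub_mem hsP hs1; simpa using this))
  have hsx : s • x ∈ Submodule.span R (Set.range v) := hs (Submodule.smul_mem_pointwise_smul _ _ _ hx)
  obtain ⟨a, ha⟩ := (Submodule.mem_span_range_iff_exists_fun R).1 hsx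
  have hsJ : s • x ∈ J • Submodule.span R (Set.range (id : Q → Q)) := by
    simpa using Submodule.smul_mem _ s hxJ
  obtain ⟨j, hj, hjs⟩ := (Submodule.mem_ideal_smul_span_iff_exists_sum J _ _).1 hsJ
  have hrel : ∑ i : Fin n ⊕ j.support, (Sum.elim a (fun q : j.support => - j q)) i •
      (Sum.elim v (fun q : j.support => (q : Q))) i = 0 := by
    rw [Fintype.sum_sum_type]
    simp only [Sum.elim_inl, Sum.elim_inr, ha, neg_smul, Finset.sum_neg_distrib]
    rw [← hjs, Finsupp.sum, Finset.sum_coe_sort j.support (fun q => j q • q)]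
    simp
  obtain ⟨k, b, y, hb1, hb2⟩ := Module.Flat.isTrivialRelation_of_sum_smul_eq_zero hrel
  let b' : Matrix (Fin n) (Fin k) R := fun i l => b (Sum.inl i) l
  have hab : ∀ l, ∑ i, a i * b' i l ∈ J := by
    intro l
    have := hb2 l
    rw [Fintype.sum_sum_type, add_eq_zero_iff_eq_neg] at this
    simp only [Sum.elim_inl, Sum.elim_inr] at this
    show ∑ i, a i * b (Sum.inl i) l ∈ J
    rw [this]
    exact neg_mem (sum_mem fun q _ => J.mul_mem_right _ (neg_mem (hj _)))
  obtain ⟨c, hc⟩ := aux_matrix P b' (by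
    intro c hc
    apply hind
    refine h P hP _ (Submodule.sum_mem _ fun i _ => Submodule.smul_mem _ _ (hvF i)) ?_
    have : ∑ i, c i • v i = ∑ l, (∑ i, c i * b' i l) • y l := by
      simp only [Finset.sum_smul]
      rw [Finset.sum_comm]
      refine Finset.sum_congr rfl fun i _ => ?_
      have := hb1 (Sum.inl i)
      simp only [Sum.elim_inl] at this
      rw [this, Finset.smul_sum]
      simp [b', mul_smul]
    rw [this]
    exact Submodule.sum_mem _ fun l _ => Submodule.smul_mem_smul (hc l) trivial)
  have hJv : ∀ {n m : ℕ} (u : Fin n → R) (M : Matrix (Fin n) (Fin m) R), (∀ i, u i ∈ J) → ∀ i, Matrix.vecMul u M i ∈ J := by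
    intro n m u M hu i
    rw [Matrix.vecMul, dotProduct]
    exact sum_mem fun q _ => J.mul_mem_right _ (hu q)
  have hta : ∀ i, (b' * c).det * a i ∈ J := by
    intro i
    have h1 := hJv _ (b' * c).adjugate (hJv (Matrix.vecMul a b') c hab) i
    rw [Matrix.vecMul_vecMul, Matrix.vecMul_vecMul, ← Matrix.mul_assoc, Matrix.mul_adjugate] at h1
    simpa [Matrix.vecMul_smul] using h1
  have hfin : (b' * c).det * s ∈ K := by
    show ((b' * c).det * s) • x ∈ J • F
    rw [mul_smul, ← ha, Finset.smul_sum]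
    simp only [← mul_smul]
    exact Submodule.sum_mem _ fun i _ => Submodule.smul_mem_smul (hta i) (hvF i)
  rcases hP.isPrime.mem_or_mem (hKP hfin) with h1 | h1
  · exact hc h1
  · exact hsP h1

theorem FPV_quotients_flat
    (p : ℕ) (hp : p.Prime) (R : Type*) [CommRing R] [CharP R p]
    (mv : ℕ) (d : Fin mv → ℕ) (I : Ideal (MvPolynomial (Fin mv) R))
    (htl : ∃ s : Finset (MvPolynomial (Fin mv) R),
      (∀ f ∈ s, ∃ l : ℕ, f ∈ FPV p R mv d l) ∧ I = Ideal.span s)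
    (hflat : Module.Flat R (MvPolynomial (Fin mv) R ⧸ I)) (N : ℕ) :
    Module.Flat R
        (↥(FPV p R mv d N) ⧸
          Submodule.comap (FPV p R mv d N).subtype (I.restrictScalars R)) ∧
    Module.Flat R
        (↥(weightedHomogeneousSubmodule R (fun i => p ^ d i) (p ^ N)) ⧸
          Submodule.comap (weightedHomogeneousSubmodule R (fun i => p ^ d i) (p ^ N)).subtype
            (FPV p R mv d N ⊔
              (I.restrictScalars R ⊓
                weightedHomogeneousSubmodule R (fun i => p ^ d i) (p ^ N)))) := by
  have : Fact p.Prime := ⟨hp⟩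
  obtain ⟨s, hs, hI⟩ := htl
  let μ : MvPolynomial (Fin mv) R →ₗ[R] MvPolynomial (Fin mv) R ⧸ I :=
    (Ideal.Quotient.mkₐ R I).toLinearMap
  have hμ : ∀ x, μ x = 0 ↔ x ∈ I := fun x => Ideal.Quotient.eq_zero_iff_mem
  let g : FPV p R mv d N →ₗ[R] MvPolynomial (Fin mv) R ⧸ I := μ ∘ₗ (FPV p R mv d N).subtype
  have hker : LinearMap.ker g =
      Submodule.comap (FPV p R mv d N).subtype (I.restrictScalars R) := by
    ext x
    exact hμ x
  have hFPVfg : (FPV p R mv d N).FG := by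
    refine Submodule.fg_span ((Set.finite_range
      (fun i : Fin mv => (X i ^ p ^ (N - d i) : MvPolynomial (Fin mv) R))).subset ?_)
    rintro _ ⟨i, -, rfl⟩
    exact ⟨i, rfl⟩
  have hfg : (LinearMap.range g).FG := by
    have : Module.Finite R (FPV p R mv d N) := Module.Finite.iff_fg.2 hFPVfg
    rw [LinearMap.range_eq_map]
    exact (Module.Finite.fg_top).map g
  have hq : Module.Flat R ((MvPolynomial (Fin mv) R ⧸ I) ⧸ LinearMap.range g) := by
    refine aux_quot_flat _ (fun J x hx hxJ => aux_pure _ hfg ?_ J x hx hxJ)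
    intro P hP x hx hxP
    by_contra hcon
    obtain ⟨L, hL⟩ := aux_functional _ P x hx hcon
    obtain ⟨y, rfl⟩ := hx
    refine hL (aux_key p R mv d I s hs hI N P (L ∘ₗ g.rangeRestrict) ?_ y hxP)
    intro f hf
    rw [LinearMap.comp_apply]
    have : g.rangeRestrict f = 0 := Subtype.ext ((hμ f).2 hf)
    rw [this, map_zero]
  constructor
  · have hF := aux_sub_flat (LinearMap.range g)
    rw [← hker]
    exact Module.Flat.of_linearEquiv g.quotKerEquivRange
  · set W := weightedHomogeneousSubmodule R (fun i => p ^ d i) (p ^ N) with hW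
    have hFW : FPV p R mv d N ≤ W := FPV_homog p R mv d N
    let _ := MvPolynomial.weightedGradedAlgebra R (fun i : Fin mv => p ^ d i)
    have hIh : I.IsHomogeneous (weightedHomogeneousSubmodule R (fun i : Fin mv => p ^ d i)) := by
      rw [hI]
      refine Ideal.homogeneous_span _ _ fun f hf => ?_
      obtain ⟨l, hl⟩ := hs f hf
      exact ⟨p ^ l, FPV_homog p R mv d l hl⟩
    set U := Submodule.comap W.subtype (FPV p R mv d N ⊔ (I.restrictScalars R ⊓ W)) with hU
    -- the projection to the homogeneous component
    let π : MvPolynomial (Fin mv) R →ₗ[R] W :=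
      (weightedHomogeneousComponent (fun i : Fin mv => p ^ d i) (p ^ N)).codRestrict W
        (fun x => weightedHomogeneousComponent_mem _ x _)
    have hπ : ∀ x : W, π x = x := fun x => Subtype.ext
      ((weightedHomogeneousComponent_of_mem x.2).trans (if_pos rfl))
    let i : (W ⧸ U) →ₗ[R] ((MvPolynomial (Fin mv) R ⧸ I) ⧸ LinearMap.range g) :=
      U.liftQ ((LinearMap.range g).mkQ ∘ₗ μ ∘ₗ W.subtype) (by
        rintro x hx
        obtain ⟨a, ha, b, hb, hab⟩ := Submodule.mem_sup.1 hx
        have hab' : a + b = (x : MvPolynomial (Fin mv) R) := hab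
        rw [LinearMap.mem_ker]
        simp only [LinearMap.comp_apply, Submodule.subtype_apply]
        rw [← hab', map_add, (hμ b).2 hb.1, add_zero]
        exact (Submodule.Quotient.mk_eq_zero _).2 ⟨⟨a, ha⟩, rfl⟩)
    let r0 : (MvPolynomial (Fin mv) R ⧸ I) →ₗ[R] (W ⧸ U) :=
      (Submodule.liftQ (I.restrictScalars R) (U.mkQ ∘ₗ π) (by
        intro x hx
        refine (Submodule.Quotient.mk_eq_zero _).2 (Submodule.mem_sup_right ⟨?_, (π x).2⟩)
        exact weightedHomogeneousComponent_mem_of_mem R _ hIh hx _) :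
        (MvPolynomial (Fin mv) R ⧸ (I.restrictScalars R)) →ₗ[R] (W ⧸ U)) ∘ₗ
        (Submodule.Quotient.restrictScalarsEquiv R I).symm.toLinearMap
    have hr0 : ∀ x, r0 (μ x) = U.mkQ (π x) := fun x => rfl
    let r : ((MvPolynomial (Fin mv) R ⧸ I) ⧸ LinearMap.range g) →ₗ[R] (W ⧸ U) :=
      (LinearMap.range g).liftQ r0 (by
        rintro _ ⟨y, rfl⟩
        rw [LinearMap.mem_ker]
        show r0 (μ y) = 0
        rw [hr0]
        refine (Submodule.Quotient.mk_eq_zero _).2 (Submodule.mem_sup_left ?_)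
        have := hπ ⟨y, hFW y.2⟩
        show ((π y : W) : MvPolynomial (Fin mv) R) ∈ _
        rw [this]
        exact y.2)
    refine Module.Flat.of_retract i r ?_
    ext x
    show r0 (μ x) = U.mkQ x
    rw [hr0, hπ]
end

section
/- Let p be a prime, R a commutative ring of characteristic p, and R[𝔛] the graded polynomial ring in variables x_1,…,x_m with deg x_i = p^{d_i}. Let I ⊆ R[𝔛] be a twisted-linear ideal generated by twisted-linear elements of degree ≤ p^n, and assume that the homogeneous component (R[𝔛]/I)_d is flat over R for every degree d ≤ p^n. Then R[𝔛]/I is flat over R. -/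
open MvPolynomial

theorem tl_flat_quot {A Q P : Type*} [CommRing A] [CommRing Q] [CommRing P] [Algebra A Q]
    [Algebra A P] (φ : Q →ₐ[A] P) (hφ : φ.toRingHom.Flat) (q : Ideal Q)
    [Module.Flat A (Q ⧸ q)] : Module.Flat A (P ⧸ q.map φ.toRingHom) := by
  let _ := φ.toRingHom.toAlgebra
  have : IsScalarTower A Q P := IsScalarTower.of_algebraMap_eq' φ.comp_algebraMap.symm
  have : Module.Flat Q P := hφ
  have : Module.Flat A (TensorProduct Q (Q ⧸ q) P) := Module.Flat.trans A (Q ⧸ q) _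
  let e := (TensorProduct.quotTensorEquivQuotSMul P q).restrictScalars A
  have := Module.Flat.of_linearEquiv e.symm
  have h : (q.map φ.toRingHom).restrictScalars Q = q • (⊤ : Submodule Q P) := by
    rw [Ideal.smul_top_eq_map]; rfl
  have e2 : (P ⧸ q.map φ.toRingHom) ≃ₗ[A] (P ⧸ (q • (⊤ : Submodule Q P))) :=
    ((Submodule.Quotient.restrictScalarsEquiv Q (q.map φ.toRingHom)).symm.trans
      (Submodule.quotEquivOfEq _ _ h)).restrictScalars A
  exact Module.Flat.of_linearEquiv e2

theorem tl_flat_vars {A σ : Type*} [CommRing A] (S : Set σ) :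
    Module.Flat A (MvPolynomial σ A ⧸ Ideal.span ((X : σ → MvPolynomial σ A) '' S)) := by
  classical
  let q := Ideal.span ((X : σ → MvPolynomial σ A) '' S)
  let κ : MvPolynomial σ A →ₐ[A] MvPolynomial σ A := aeval (fun i => if i ∈ S then 0 else X i)
  have hκ : ∀ a ∈ q, κ a = 0 := by
    intro a ha
    have : q ≤ RingHom.ker κ := by
      rw [Ideal.span_le]
      rintro _ ⟨i, hi, rfl⟩
      simp [κ, RingHom.mem_ker, hi]
    exact this ha
  let i := Ideal.Quotient.liftₐ q κ hκ
  have hiX : ∀ x, i (Ideal.Quotient.mkₐ A q x) = κ x := fun x => rfl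
  refine Module.Flat.of_retract (M := MvPolynomial σ A) i.toLinearMap (Ideal.Quotient.mkₐ A q).toLinearMap ?_
  have : (Ideal.Quotient.mkₐ A q).comp i = AlgHom.id A _ := by
    apply Ideal.Quotient.algHom_ext
    apply MvPolynomial.algHom_ext
    intro j
    by_cases hj : j ∈ S
    · have : (X j : MvPolynomial σ A) ∈ q := Ideal.subset_span ⟨j, hj, rfl⟩
      simp only [AlgHom.comp_apply, AlgHom.id_apply, hiX]
      simp [κ, hj, Ideal.Quotient.eq_zero_iff_mem.2 this]
    · simp only [AlgHom.comp_apply, AlgHom.id_apply, hiX]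
      simp [κ, hj]
  apply LinearMap.ext
  intro x
  exact DFunLike.congr_fun this x

theorem tl_flat_of_basis {Q P : Type*} [CommRing Q] [CommRing P] (φ : Q →+* P) {D : ℕ}
    (v : Fin D → P) (h1 : ∀ c : Fin D → Q, ∑ k, φ (c k) * v k = 0 → ∀ k, c k = 0)
    (h2 : ∀ x, ∃ c : Fin D → Q, ∑ k, φ (c k) * v k = x) : φ.Flat := by
  let _ := φ.toAlgebra
  have hli : LinearIndependent Q v := by
    rw [Fintype.linearIndependent_iff]
    exact h1
  have hsp : ⊤ ≤ Submodule.span Q (Set.range v) := by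
    intro x _
    obtain ⟨c, rfl⟩ := h2 x
    exact Submodule.sum_mem _ fun k _ =>
      Submodule.smul_mem _ (c k) (Submodule.subset_span ⟨k, rfl⟩)
  have : Module.Free Q P := Module.Free.of_basis (Module.Basis.mk hli hsp)
  exact (inferInstance : Module.Flat Q P)

/-- the map raising one variable to the power D -/
theorem tl_flat_pow {A σ : Type*} [CommRing A] [DecidableEq σ] (i : σ) (D : ℕ) (hD : 0 < D) :
    (aeval (Function.update X i (X i ^ D)) :
      MvPolynomial σ A →ₐ[A] MvPolynomial σ A).toRingHom.Flat := by
  set ψ := (aeval (Function.update X i (X i ^ D)) : MvPolynomial σ A →ₐ[A] MvPolynomial σ A) with hψ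
  let s : (σ →₀ ℕ) → (σ →₀ ℕ) := fun e => e.update i (D * e i)
  have hmon : ∀ e a, ψ (monomial e a) = monomial (s e) a := by
    intro e a
    rw [hψ, aeval_monomial, MvPolynomial.monomial_eq (s := s e), MvPolynomial.algebraMap_eq]
    congr 1
    rw [Finsupp.prod_of_support_subset (s := insert i e.support) _ (by simp) _ (by simp),
      Finsupp.prod_of_support_subset (s := insert i e.support) _ ?_ _ (by simp)]
    · apply Finset.prod_congr rfl
      intro j _
      by_cases h : j = i
      · subst h; simp [s, pow_mul]
      · simp [s, h]
    · intro j
      by_cases h : j = i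
      · subst h; simp
      · simp [s, h]
  have hinj : ∀ {e e' : σ →₀ ℕ} {k k' : Fin D},
      s e + Finsupp.single i k.1 = s e' + Finsupp.single i k'.1 → e = e' ∧ k = k' := by
    intro e e' k k' h
    have hi := DFunLike.congr_fun h i
    simp [s] at hi
    have hk : k.1 = k'.1 := by
      have := congrArg (· % D) hi
      simpa [Nat.mod_eq_of_lt k.2, Nat.mod_eq_of_lt k'.2] using this
    refine ⟨?_, Fin.ext hk⟩
    ext j
    by_cases hj : j = i
    · subst hj
      rw [hk] at hi
      exact Nat.eq_of_mul_eq_mul_left hD (by omega)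
    · have := DFunLike.congr_fun h j
      simpa [s, hj, Finsupp.single_apply, Ne.symm hj, eq_comm] using this
  have hcoef : ∀ (q : MvPolynomial σ A) (e : σ →₀ ℕ) (k k' : Fin D),
      coeff (s e + Finsupp.single i k.1) (ψ q * X i ^ k'.1) = if k' = k then coeff e q else 0 := by
    intro q e k k'
    induction q using MvPolynomial.induction_on' with
    | monomial u a =>
      rw [hmon, X_pow_eq_monomial, monomial_mul, coeff_monomial, coeff_monomial, mul_one]
      by_cases h : s u + Finsupp.single i k'.1 = s e + Finsupp.single i k.1
      · obtain ⟨h1, h2⟩ := hinj h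
        simp [h1, h2]
      · rw [if_neg h]
        split_ifs with h1 h2
        · exact absurd (by rw [h1, h2]) h
        · rfl
        · rfl
    | add p q hp hq => rw [map_add, add_mul, coeff_add, hp, hq]; split_ifs <;> simp
  refine tl_flat_of_basis ψ.toRingHom (D := D) (fun k => X i ^ k.1) ?_ ?_
  · intro c hc k
    ext e
    have := congrArg (coeff (s e + Finsupp.single i k.1)) hc
    rw [coeff_sum] at this
    have h3 : ∀ k', coeff (s e + Finsupp.single i k.1) (ψ.toRingHom (c k') * X i ^ k'.1)
      = if k' = k then coeff e (c k') else 0 := fun k' => hcoef (c k') e k k'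
    simp only [h3] at this
    simpa using this
  · intro x
    induction x using MvPolynomial.induction_on' with
    | monomial u a =>
      refine ⟨Pi.single ⟨u i % D, Nat.mod_lt _ hD⟩ (monomial (u.update i (u i / D)) a), ?_⟩
      rw [Finset.sum_eq_single ⟨u i % D, Nat.mod_lt _ hD⟩]
      · rw [Pi.single_eq_same]
        have := hmon (u.update i (u i / D)) a
        change ψ _ * _ = _
        rw [this, X_pow_eq_monomial, monomial_mul, mul_one]
        refine congrArg (fun e => monomial e a) ?_
        ext j
        by_cases hj : j = i
        · subst hj; simp [s, Nat.div_add_mod]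
        · simp [s, hj]
      · intro k _ hk
        rw [Pi.single_eq_of_ne hk]; simp
      · simp
    | add p q hp hq =>
      obtain ⟨c, rfl⟩ := hp
      obtain ⟨c', rfl⟩ := hq
      exact ⟨c + c', by simp only [Pi.add_apply, map_add, add_mul, Finset.sum_add_distrib]⟩

/-- one elementary step -/
theorem tl_flat_step {A σ : Type*} [CommRing A] [DecidableEq σ] (i : σ) (D : ℕ) (hD : 0 < D)
    (u : A) (hu : IsUnit u) (h f : MvPolynomial σ A) (hf : f = C u * X i ^ D + h)
    (hh : ∀ y : MvPolynomial σ A, aeval (Function.update X i y) h = h) :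
    (aeval (Function.update X i f) :
      MvPolynomial σ A →ₐ[A] MvPolynomial σ A).toRingHom.Flat := by
  obtain ⟨u, rfl⟩ := hu
  let θ : MvPolynomial σ A →ₐ[A] MvPolynomial σ A := aeval (Function.update X i (C u.1 * X i + h))
  let θ' : MvPolynomial σ A →ₐ[A] MvPolynomial σ A :=
    aeval (Function.update X i (C (u⁻¹).1 * (X i - h)))
  let ψ := (aeval (Function.update X i (X i ^ D)) : MvPolynomial σ A →ₐ[A] MvPolynomial σ A)
  have hC : (C u.1 * C (u⁻¹).1 : MvPolynomial σ A) = 1 := by rw [← C_mul]; simp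
  have hθ : ∀ j, θ (X j) = Function.update X i (C u.1 * X i + h) j := fun j => aeval_X _ _
  have hθ' : ∀ j, θ' (X j) = Function.update X i (C (u⁻¹).1 * (X i - h)) j := fun j => aeval_X _ _
  have hψ : ∀ j, ψ (X j) = Function.update X i (X i ^ D) j := fun j => aeval_X _ _
  have hCθ : ∀ a, θ (C a) = C a := fun a => θ.commutes a
  have hCθ' : ∀ a, θ' (C a) = C a := fun a => θ'.commutes a
  have hCψ : ∀ a, ψ (C a) = C a := fun a => ψ.commutes a
  have h1 : θ.comp θ' = AlgHom.id A _ := by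
    apply MvPolynomial.algHom_ext
    intro j
    by_cases hj : j = i
    · subst hj
      simp only [AlgHom.comp_apply, hθ', Function.update_self, map_mul, map_sub, hθ, hCθ,
        AlgHom.id_apply]
      rw [show θ h = h from hh _]
      linear_combination X j * hC
    · simp [hθ', hθ, hj]
  have h2 : θ'.comp θ = AlgHom.id A _ := by
    apply MvPolynomial.algHom_ext
    intro j
    by_cases hj : j = i
    · subst hj
      simp only [AlgHom.comp_apply, hθ', Function.update_self, map_mul, map_add, hθ, hCθ',
        AlgHom.id_apply]
      rw [show θ' h = h from hh _]
      linear_combination (X j - h) * hC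
    · simp [hθ', hθ, hj]
  have hb : Function.Bijective θ.toRingHom :=
    Function.bijective_iff_has_inverse.2 ⟨θ', fun x => DFunLike.congr_fun h2 x,
      fun x => DFunLike.congr_fun h1 x⟩
  have h3 : aeval (Function.update X i f) = ψ.comp θ := by
    apply MvPolynomial.algHom_ext
    intro j
    by_cases hj : j = i
    · subst hj
      simp only [AlgHom.comp_apply, hθ, Function.update_self, map_mul, map_add, hψ, hCψ, aeval_X]
      rw [show ψ h = h from hh _, hf]
    · simp [hψ, hθ, hj]
  rw [h3]
  exact RingHom.Flat.comp (RingHom.Flat.of_bijective hb) (tl_flat_pow i D hD)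

noncomputable def tlU (p : ℕ) (A : Type*) [CommRing A] (mv : ℕ) (d : Fin mv → ℕ) (l : ℕ) (S : Finset (Fin mv)) :
    Submodule A (MvPolynomial (Fin mv) A) :=
  Submodule.span A {f | ∃ i : Fin mv, i ∉ S ∧ d i ≤ l ∧ f = X i ^ p ^ (l - d i)}

noncomputable def tlT {A : Type*} [CommRing A] {mv : ℕ} (φ : MvPolynomial (Fin mv) A →ₐ[A] MvPolynomial (Fin mv) A)
    (S : Finset (Fin mv)) : Ideal (MvPolynomial (Fin mv) A) :=
  Ideal.span ((fun i => φ (X i)) '' (S : Set (Fin mv)))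

structure tlInv (p : ℕ) {A : Type*} [CommRing A] {mv : ℕ} (d : Fin mv → ℕ) (l : ℕ)
    (φ : MvPolynomial (Fin mv) A →ₐ[A] MvPolynomial (Fin mv) A) (S : Finset (Fin mv)) : Prop where
  flat : φ.toRingHom.Flat
  fix : ∀ i ∉ S, φ (X i) = X i
  le : ∀ i ∈ S, d i ≤ l
  red : ∀ i ∈ S, (X i ^ p ^ (l - d i) : MvPolynomial (Fin mv) A) ∈
    (tlT φ S).restrictScalars A ⊔ tlU p A mv d l S

section
variable {p : ℕ} {A : Type*} [CommRing A] {mv : ℕ} {d : Fin mv → ℕ} {l : ℕ}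
  {φ : MvPolynomial (Fin mv) A →ₐ[A] MvPolynomial (Fin mv) A} {S : Finset (Fin mv)}

theorem tl_flat_T (h : φ.toRingHom.Flat) : Module.Flat A (MvPolynomial (Fin mv) A ⧸ tlT φ S) := by
  have := tl_flat_vars (A := A) (S : Set (Fin mv))
  have h2 := tl_flat_quot φ h (Ideal.span ((X : _ → MvPolynomial (Fin mv) A) '' (S : Set (Fin mv))))
  rw [Ideal.map_span, ← Set.image_comp] at h2
  exact h2

theorem tlInv.reduce (h : tlInv p d l φ S) :
    FPV p A mv d l ≤ (tlT φ S).restrictScalars A ⊔ tlU p A mv d l S := by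
  refine Submodule.span_le.2 ?_
  rintro _ ⟨i, hi, rfl⟩
  by_cases hS : i ∈ S
  · exact h.red i hS
  · exact Submodule.mem_sup_right (Submodule.subset_span ⟨i, hS, hi, rfl⟩)

theorem tlU_pow (hp : p.Prime) [CharP A p] {v : MvPolynomial (Fin mv) A}
    (hv : v ∈ tlU p A mv d l S) : v ^ p ∈ tlU p A mv d (l + 1) S := by
  have : Fact p.Prime := ⟨hp⟩
  induction hv using Submodule.span_induction with
  | mem x hx =>
    obtain ⟨i, hi, hd, rfl⟩ := hx
    refine Submodule.subset_span ⟨i, hi, by omega, ?_⟩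
    rw [← pow_mul, ← pow_succ, Nat.succ_sub hd]
  | zero => rw [zero_pow hp.ne_zero]; exact zero_mem _
  | add x y _ _ hx hy => rw [add_pow_char]; exact add_mem hx hy
  | smul a x _ hx => rw [smul_pow]; exact Submodule.smul_mem _ _ hx

theorem tlInv.frob (hp : p.Prime) [CharP A p] (h : tlInv p d l φ S) : tlInv p d (l + 1) φ S := by
  have : Fact p.Prime := ⟨hp⟩
  refine ⟨h.flat, h.fix, fun i hi => (h.le i hi).trans (Nat.le_succ l), fun i hi => ?_⟩
  obtain ⟨t, ht, v, hv, htv⟩ := Submodule.mem_sup.1 (h.red i hi)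
  rw [Nat.succ_sub (h.le i hi), pow_succ, pow_mul, ← htv, add_pow_char]
  refine Submodule.add_mem_sup ?_ (tlU_pow hp hv)
  exact Ideal.pow_mem_of_mem (tlT φ S) ht p hp.pos

theorem tlU_fix {ψ : MvPolynomial (Fin mv) A →ₐ[A] MvPolynomial (Fin mv) A}
    (hψ : ∀ i ∉ S, ψ (X i) = X i) {v : MvPolynomial (Fin mv) A}
    (hv : v ∈ tlU p A mv d l S) : ψ v = v := by
  induction hv using Submodule.span_induction with
  | mem x hx =>
    obtain ⟨i, hi, hd, rfl⟩ := hx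
    rw [map_pow, hψ i hi]
  | zero => exact map_zero _
  | add x y _ _ hx hy => rw [map_add, hx, hy]
  | smul a x _ hx => rw [map_smul, hx]

theorem tlU_split {i : Fin mv} {v : MvPolynomial (Fin mv) A} (hv : v ∈ tlU p A mv d l S) :
    ∃ (c : A), ∃ h ∈ tlU p A mv d l (insert i S), v = C c * X i ^ p ^ (l - d i) + h := by
  induction hv using Submodule.span_induction with
  | mem x hx =>
    obtain ⟨j, hj, hd, rfl⟩ := hx
    by_cases hij : j = i
    · subst hij
      exact ⟨1, 0, zero_mem _, by simp⟩
    · exact ⟨0, _, Submodule.subset_span ⟨j, by simp [hij, hj], hd, rfl⟩, by simp⟩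
  | zero => exact ⟨0, 0, zero_mem _, by simp⟩
  | add x y _ _ hx hy =>
    obtain ⟨c, h, hh, rfl⟩ := hx
    obtain ⟨c', h', hh', rfl⟩ := hy
    exact ⟨c + c', h + h', add_mem hh hh', by rw [C_add]; ring⟩
  | smul a x _ hx =>
    obtain ⟨c, h, hh, rfl⟩ := hx
    exact ⟨a * c, a • h, Submodule.smul_mem _ _ hh, by rw [smul_add, C_mul, smul_eq_C_mul, mul_assoc]⟩

theorem tlU_coeff {v : MvPolynomial (Fin mv) A} (hv : v ∈ tlU p A mv d l S) (e : Fin mv →₀ ℕ)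
    (he : coeff e v ≠ 0) : ∃ i, i ∉ S ∧ d i ≤ l ∧ e = Finsupp.single i (p ^ (l - d i)) := by
  contrapose! he
  induction hv using Submodule.span_induction with
  | mem x hx =>
    obtain ⟨j, hj, hd, rfl⟩ := hx
    rw [coeff_X_pow, if_neg]
    exact fun h => he j hj hd h.symm
  | zero => exact coeff_zero _
  | add x y _ _ hx hy => rw [coeff_add, hx, hy, add_zero]
  | smul a x _ hx => rw [coeff_smul, hx, smul_zero]

theorem tlInv.pivot (hp : p.Prime) (h : tlInv p d l φ S) {f : MvPolynomial (Fin mv) A}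
    (hf : f ∈ tlU p A mv d l S) {i : Fin mv} (hi : i ∉ S) (hd : d i ≤ l)
    (hu : IsUnit (coeff (Finsupp.single i (p ^ (l - d i))) f)) :
    ∃ φ', tlInv p d l φ' (insert i S) ∧ tlT φ' (insert i S) = tlT φ S ⊔ Ideal.span {f} := by
  have hD : 0 < p ^ (l - d i) := pow_pos hp.pos _
  obtain ⟨c, v, hv, hfv⟩ := tlU_split (i := i) hf
  have hc : coeff (Finsupp.single i (p ^ (l - d i))) f = c := by
    have : coeff (Finsupp.single i (p ^ (l - d i))) v = 0 := by
      by_contra hne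
      obtain ⟨j, hj, _, he⟩ := tlU_coeff hv _ hne
      have := (Finsupp.single_left_inj (b := p ^ (l - d i)) hD.ne' (a := i) (a' := j)).1
      have h1 := DFunLike.congr_fun he i
      rw [Finsupp.single_eq_same, Finsupp.single_apply] at h1
      split_ifs at h1 with h2
      · subst h2; simp at hj
      · omega
    rw [hfv, coeff_add, this, coeff_C_mul, coeff_X_pow, if_pos rfl]; simp
  rw [hc] at hu
  have hstep := tl_flat_step i _ hD c hu v f hfv (fun y => by
    apply tlU_fix _ hv
    intro j hj
    rw [aeval_X, Function.update_of_ne]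
    rintro rfl
    simp at hj)
  set ψ := (aeval (Function.update X i f) : MvPolynomial (Fin mv) A →ₐ[A] MvPolynomial (Fin mv) A)
  have hφi : (φ.comp ψ) (X i) = f := by
    simp only [AlgHom.comp_apply, ψ, aeval_X, Function.update_self]
    exact tlU_fix h.fix hf
  have hφj : ∀ j, j ≠ i → (φ.comp ψ) (X j) = φ (X j) := by
    intro j hj
    simp only [AlgHom.comp_apply, ψ, aeval_X, Function.update_of_ne hj]
  have hT : tlT (φ.comp ψ) (insert i S) = tlT φ S ⊔ Ideal.span {f} := by
    rw [tlT, tlT, ← Ideal.span_union, Finset.coe_insert, Set.image_insert_eq, hφi,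
      Set.union_singleton]
    congr 2
    apply Set.image_congr
    intro j hj
    exact hφj j (by rintro rfl; exact hi hj)
  have hfT : f ∈ tlT (φ.comp ψ) (insert i S) := by
    rw [hT]; exact Ideal.mem_sup_right (Ideal.mem_span_singleton_self f)
  have hredi : (X i ^ p ^ (l - d i) : MvPolynomial (Fin mv) A) ∈
      (tlT (φ.comp ψ) (insert i S)).restrictScalars A ⊔ tlU p A mv d l (insert i S) := by
    obtain ⟨u, rfl⟩ := hu
    have : (X i ^ p ^ (l - d i) : MvPolynomial (Fin mv) A) =
        (u⁻¹).1 • f + (-(u⁻¹).1) • v := by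
      rw [hfv, smul_eq_C_mul, smul_eq_C_mul, C_neg]
      have hC : (C u.1 * C (u⁻¹).1 : MvPolynomial (Fin mv) A) = 1 := by rw [← C_mul]; simp
      linear_combination -(X i ^ p ^ (l - d i)) * hC
    rw [this]
    exact Submodule.add_mem_sup (Submodule.smul_mem _ _ hfT) (Submodule.smul_mem _ _ hv)
  refine ⟨φ.comp ψ, ⟨RingHom.Flat.comp hstep h.flat, ?_, ?_, ?_⟩, hT⟩
  · intro j hj
    rw [Finset.mem_insert, not_or] at hj
    rw [hφj j hj.1, h.fix j hj.2]
  · intro j hj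
    rcases Finset.mem_insert.1 hj with rfl | hj
    · exact hd
    · exact h.le j hj
  · intro j hj
    rcases Finset.mem_insert.1 hj with rfl | hj
    · exact hredi
    · refine (sup_le ?_ ?_ : (tlT φ S).restrictScalars A ⊔ tlU p A mv d l S ≤ _) (h.red j hj)
      · refine le_sup_of_le_left ?_
        rw [hT]
        exact (le_sup_left : tlT φ S ≤ tlT φ S ⊔ Ideal.span {f})
      · refine Submodule.span_le.2 ?_
        rintro _ ⟨k, hk, hkd, rfl⟩
        by_cases hki : k = i
        · subst hki; exact hredi
        · exact Submodule.mem_sup_right (Submodule.subset_span ⟨k, by simp [hki, hk], hkd, rfl⟩)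

theorem tlU_le : tlU p A mv d l S ≤ FPV p A mv d l :=
  Submodule.span_mono fun _ ⟨i, _, h⟩ => ⟨i, h⟩

theorem FPV_le : FPV p A mv d l ≤ weightedHomogeneousSubmodule A (fun i => p ^ d i) (p ^ l) := by
  refine Submodule.span_le.2 ?_
  rintro _ ⟨i, hi, rfl⟩
  have := (isWeightedHomogeneous_X A (fun i => p ^ d i) i).pow (p ^ (l - d i))
  rw [smul_eq_mul, ← pow_add, Nat.sub_add_cancel hi] at this
  exact this

end

noncomputable def tlG (p : ℕ) {A : Type*} [CommRing A] {mv : ℕ} (d : Fin mv → ℕ)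
    (s : Finset (MvPolynomial (Fin mv) A)) (k : ℕ) : Ideal (MvPolynomial (Fin mv) A) :=
  Ideal.span {f | f ∈ s ∧ ∃ l, l < k ∧ f ∈ FPV p A mv d l}

/-- components of elements of the ideal -/
theorem tl_component {p : ℕ} (hp : p.Prime) {A : Type*} [CommRing A] {mv : ℕ} {d : Fin mv → ℕ}
    {s : Finset (MvPolynomial (Fin mv) A)}
    (hs : ∀ f ∈ s, ∃ l : ℕ, f ∈ FPV p A mv d l) (k : ℕ)
    {h : MvPolynomial (Fin mv) A} (hI : h ∈ Ideal.span (s : Set (MvPolynomial (Fin mv) A)))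
    (hW : h ∈ weightedHomogeneousSubmodule A (fun i => p ^ d i) (p ^ k)) :
    h ∈ (tlG p d s k).restrictScalars A ⊔ Submodule.span A {f | f ∈ s ∧ f ∈ FPV p A mv d k} := by
  set N := (tlG p d s k).restrictScalars A ⊔ Submodule.span A {f | f ∈ s ∧ f ∈ FPV p A mv d k}
    with hN
  let w : Fin mv → ℕ := fun i => p ^ d i
  rw [← IsWeightedHomogeneous.weightedHomogeneousComponent_same hW]
  obtain ⟨c, -, rfl⟩ := Submodule.mem_span_finset.1 hI
  rw [map_sum]
  refine Submodule.sum_mem _ fun f hf => ?_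
  obtain ⟨l, hl⟩ := hs f hf
  rw [smul_eq_mul]
  induction c f using MvPolynomial.induction_on' with
  | add x y hx hy => rw [add_mul, map_add]; exact add_mem hx hy
  | monomial u a =>
    have hom : IsWeightedHomogeneous w (monomial u a * f) (Finsupp.weight w u + p ^ l) :=
      (isWeightedHomogeneous_monomial w u a rfl).mul (FPV_le hl)
    by_cases hk : Finsupp.weight w u + p ^ l = p ^ k
    · rw [hk] at hom
      rw [IsWeightedHomogeneous.weightedHomogeneousComponent_same hom]
      have hlk : l ≤ k := (Nat.pow_le_pow_iff_right hp.one_lt).1 (by omega)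
      rcases hlk.lt_or_eq with hlk | rfl
      · refine Submodule.mem_sup_left ?_
        exact Ideal.mul_mem_left (tlG p d s k) _ (Ideal.subset_span ⟨hf, l, hlk, hl⟩)
      · have hu : u = 0 := by
          have h0 : Finsupp.weight w u = 0 := by omega
          have : Finsupp.NonTorsionWeight ℕ w :=
            Finsupp.nonTorsionWeight_of ℕ w (fun i => (pow_pos hp.pos (d i)).ne')
          exact (Finsupp.weight_eq_zero_iff_eq_zero w).1 h0
        subst hu
        refine Submodule.mem_sup_right ?_
        have := Submodule.smul_mem _ a (Submodule.subset_span (R := A)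
          (s := {f | f ∈ s ∧ f ∈ FPV p A mv d l}) ⟨hf, hl⟩)
        rwa [smul_eq_C_mul] at this
    · rw [hom.weightedHomogeneousComponent_ne _ (Ne.symm hk)]
      exact zero_mem _

theorem tl_local {p : ℕ} (hp : p.Prime) {A : Type*} [CommRing A] [IsLocalRing A] [CharP A p]
    {mv : ℕ} {d : Fin mv → ℕ} (n : ℕ) (s : Finset (MvPolynomial (Fin mv) A))
    (hs : ∀ f ∈ s, ∃ l : ℕ, l ≤ n ∧ f ∈ FPV p A mv d l)
    (H : ∀ k ≤ n, ∀ h ∈ Ideal.span (s : Set (MvPolynomial (Fin mv) A)),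
      h ∈ weightedHomogeneousSubmodule A (fun i => p ^ d i) (p ^ k) →
      (∀ e, coeff e h ∈ IsLocalRing.maximalIdeal A) →
      h ∈ IsLocalRing.maximalIdeal A •
        ((Ideal.span (s : Set (MvPolynomial (Fin mv) A))).restrictScalars A ⊓
          weightedHomogeneousSubmodule A (fun i => p ^ d i) (p ^ k))) :
    Module.Flat A (MvPolynomial (Fin mv) A ⧸ Ideal.span (s : Set (MvPolynomial (Fin mv) A))) := by
  set I := Ideal.span (s : Set (MvPolynomial (Fin mv) A)) with hI
  set 𝔪 := IsLocalRing.maximalIdeal A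
  have hGI : ∀ k, tlG p d s k ≤ I := fun k => Ideal.span_mono fun f hf => hf.1
  have hGmono : ∀ k, tlG p d s k ≤ tlG p d s (k + 1) := fun k =>
    Ideal.span_mono fun f ⟨hf, l, hl, h⟩ => ⟨hf, l, hl.trans (Nat.lt_succ_self k), h⟩
  have hGk : ∀ k f, f ∈ s → f ∈ FPV p A mv d k → f ∈ tlG p d s (k + 1) := fun k f hf h =>
    Ideal.subset_span ⟨hf, k, Nat.lt_succ_self k, h⟩
  have main : ∀ k ≤ n + 1, ∃ φ S, tlInv p d k φ S ∧ tlT φ S = tlG p d s k := by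
    intro k
    induction k with
    | zero =>
      intro _
      refine ⟨AlgHom.id A _, ∅, ⟨RingHom.Flat.id _, fun _ _ => rfl, by simp, by simp⟩, ?_⟩
      simp [tlT, tlG]
    | succ k ih =>
      intro hk
      obtain ⟨φ₀, S₀, h₀, hT₀⟩ := ih (by omega)
      let good : Finset (Fin mv) → Prop := fun S => ∃ φ, tlInv p d k φ S ∧
        tlG p d s k ≤ tlT φ S ∧ tlT φ S ≤ tlG p d s (k + 1)
      have hex : {S | good S}.Nonempty := ⟨S₀, φ₀, h₀, hT₀.ge, hT₀.le.trans (hGmono k)⟩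
      obtain ⟨S, hS⟩ := (Set.toFinite {S | good S}).exists_maximal hex
      obtain ⟨φ, hinv, hle, hge⟩ := hS.1
      refine ⟨φ, S, hinv.frob hp, le_antisymm hge ?_⟩
      set N := Submodule.span A {f | f ∈ s ∧ f ∈ FPV p A mv d k} with hN
      have key : N ≤ (tlT φ S).restrictScalars A := by
        have hfg : N.FG := Submodule.fg_span (s.finite_toSet.subset fun f hf => hf.1)
        refine Submodule.le_of_le_smul_of_le_jacobson_bot (I := 𝔪) hfg
          (IsLocalRing.maximalIdeal_le_jacobson _) ?_
        rw [hN, Submodule.span_le, ← hN]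
        rintro g ⟨hgs, hgk⟩
        obtain ⟨t, ht, v, hv, rfl⟩ := Submodule.mem_sup.1 (hinv.reduce hgk)
        refine add_mem (Submodule.mem_sup_left ht) ?_
        have hvG : v ∈ tlG p d s (k + 1) :=
          (Ideal.add_mem_iff_right _ (hge ht)).1 (hGk k _ hgs hgk)
        have hvI : v ∈ I := hGI _ hvG
        have hvm : ∀ e, coeff e v ∈ 𝔪 := by
          intro e
          by_contra hu
          have hu : IsUnit (coeff e v) := by
            by_contra h; exact hu ((IsLocalRing.mem_maximalIdeal _).2 h)
          obtain ⟨i, hi, hd, rfl⟩ := tlU_coeff hv e hu.ne_zero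
          obtain ⟨φ', hinv', hT'⟩ := hinv.pivot hp hv hi hd hu
          have : good (insert i S) := by
            refine ⟨φ', hinv', ?_, ?_⟩
            · rw [hT']; exact le_sup_of_le_left hle
            · rw [hT']
              exact sup_le hge ((Ideal.span_singleton_le_iff_mem _).2 hvG)
          exact hi (hS.2 this (Finset.subset_insert i S) (Finset.mem_insert_self i S))
        have h1 := H k (by omega) v hvI (FPV_le (tlU_le hv)) hvm
        have h2 : I.restrictScalars A ⊓ weightedHomogeneousSubmodule A (fun i => p ^ d i) (p ^ k)
            ≤ (tlT φ S).restrictScalars A ⊔ N := by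
          rintro x ⟨hx1, hx2⟩
          have := tl_component hp (fun f hf => (hs f hf).imp fun _ h => h.2) k hx1 hx2
          exact sup_le_sup_right (show (tlG p d s k).restrictScalars A ≤
            (tlT φ S).restrictScalars A from hle) _ this
        have h3 := Submodule.smul_mono le_rfl h2 h1
        rw [Submodule.smul_sup] at h3
        have h4 : 𝔪 • (tlT φ S).restrictScalars A ≤ (tlT φ S).restrictScalars A :=
          Submodule.smul_le_right
        exact sup_le_sup_right h4 _ h3
      refine Ideal.span_le.2 ?_
      rintro f ⟨hf, l, hl, hfl⟩
      rcases (Nat.lt_succ_iff.1 hl).lt_or_eq with hl | rfl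
      · exact hle (Ideal.subset_span ⟨hf, l, hl, hfl⟩)
      · exact key (Submodule.subset_span ⟨hf, hfl⟩)
  obtain ⟨φ, S, hinv, hT⟩ := main (n + 1) le_rfl
  have hIT : I = tlT φ S := by
    rw [hT]
    refine le_antisymm (Ideal.span_le.2 fun f hf => ?_) (hGI _)
    obtain ⟨l, hl, h⟩ := hs f hf
    exact Ideal.subset_span ⟨hf, l, Nat.lt_succ_of_le hl, h⟩
  rw [hIT]
  exact tl_flat_T hinv.flat

/-- equational consequence of flatness -/
theorem tl_flat_crit {R : Type*} [CommRing R] {mv : ℕ} {w : Fin mv → ℕ} {D : ℕ}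
    (I : Ideal (MvPolynomial (Fin mv) R))
    [Module.Flat R (↥(weightedHomogeneousSubmodule R w D) ⧸
          Submodule.comap (weightedHomogeneousSubmodule R w D).subtype (I.restrictScalars R))]
    (𝔞 : Ideal R) (h : MvPolynomial (Fin mv) R) (hI : h ∈ I)
    (hW : h ∈ weightedHomogeneousSubmodule R w D) (h𝔞 : ∀ e, coeff e h ∈ 𝔞) :
    h ∈ 𝔞 • (I.restrictScalars R ⊓ weightedHomogeneousSubmodule R w D) := by
  classical
  set W := weightedHomogeneousSubmodule R w D
  set K := Submodule.comap W.subtype (I.restrictScalars R)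
  let m : h.support → W := fun e => ⟨monomial e.1 1,
    isWeightedHomogeneous_monomial w e.1 1 (hW (mem_support_iff.1 e.2))⟩
  have hsum : ∑ e : h.support, coeff e.1 h • m e = ⟨h, hW⟩ := by
    apply Subtype.ext
    rw [Submodule.coe_sum]
    refine Eq.trans (b := ∑ v ∈ h.support, monomial v (coeff v h)) ?_ h.as_sum.symm
    rw [← Finset.sum_coe_sort h.support]
    refine Finset.sum_congr rfl fun e _ => ?_
    simp [m, smul_monomial]
  have hrel : ∑ e : h.support, coeff e.1 h • (K.mkQ (m e)) = 0 := by
    have := congrArg K.mkQ hsum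
    rw [map_sum] at this
    simp only [map_smul] at this
    rw [this]
    exact (Submodule.Quotient.mk_eq_zero K).2 hI
  obtain ⟨κ, b, y, hy, hb⟩ := Module.Flat.isTrivialRelation_of_sum_smul_eq_zero hrel
  choose z hz using fun j => K.mkQ_surjective (y j)
  let r : h.support → W := fun e => m e - ∑ j, b e j • z j
  have hr : ∀ e, r e ∈ K := by
    intro e
    rw [← Submodule.Quotient.mk_eq_zero, ← Submodule.mkQ_apply, map_sub, map_sum, sub_eq_zero]
    simp only [map_smul, hz]
    exact hy e
  have hfin : ∑ e : h.support, coeff e.1 h • r e = ⟨h, hW⟩ := by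
    rw [← hsum]
    simp only [r, smul_sub, Finset.sum_sub_distrib, sub_eq_self, Finset.smul_sum, smul_smul]
    rw [Finset.sum_comm]
    refine Finset.sum_eq_zero fun j _ => ?_
    rw [← Finset.sum_smul, hb j, zero_smul]
  have := congrArg W.subtype hfin
  rw [map_sum] at this
  change _ = h at this
  rw [← this]
  refine Submodule.sum_mem _ fun e _ => ?_
  rw [map_smul]
  exact Submodule.smul_mem_smul (h𝔞 _) ⟨hr e, (r e).2⟩

theorem tl_map_FPV {p : ℕ} {R A : Type*} [CommRing R] [CommRing A] [Algebra R A] {mv : ℕ}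
    {d : Fin mv → ℕ} {l : ℕ} {f : MvPolynomial (Fin mv) R} (hf : f ∈ FPV p R mv d l) :
    map (algebraMap R A) f ∈ FPV p A mv d l := by
  induction hf using Submodule.span_induction with
  | mem x hx =>
    obtain ⟨i, hi, rfl⟩ := hx
    exact Submodule.subset_span ⟨i, hi, by simp⟩
  | zero => rw [map_zero]; exact zero_mem _
  | add x y _ _ hx hy => rw [map_add]; exact add_mem hx hy
  | smul a x _ hx =>
    rw [smul_eq_C_mul, map_mul, map_C, ← smul_eq_C_mul]
    exact Submodule.smul_mem _ _ hx

section
attribute [local instance] algebraMvPolynomial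

theorem tl_mem_map {R A : Type*} [CommRing R] [CommRing A] [Algebra R A] {mv : ℕ}
    (M : Submonoid R) [IsLocalization M A] {I : Ideal (MvPolynomial (Fin mv) R)}
    {z : MvPolynomial (Fin mv) A} (hz : z ∈ I.map (map (algebraMap R A))) :
    ∃ a ∈ I, ∃ r ∈ M, algebraMap R A r • z = map (algebraMap R A) a := by
  obtain ⟨⟨a, ⟨_, r, hr, rfl⟩⟩, h⟩ :=
    (IsLocalization.mem_map_algebraMap_iff (M.map (C (σ := Fin mv))) (MvPolynomial (Fin mv) A)
      (I := I)).1 hz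
  refine ⟨a.1, a.2, r, hr, ?_⟩
  rw [smul_eq_C_mul, mul_comm, ← map_C]
  exact h

theorem tl_map_eq {R A : Type*} [CommRing R] [CommRing A] [Algebra R A] {mv : ℕ}
    (M : Submonoid R) [IsLocalization M A] {x y : MvPolynomial (Fin mv) R}
    (h : map (algebraMap R A) x = map (algebraMap R A) y) :
    ∃ r ∈ M, r • x = r • y := by
  obtain ⟨⟨_, r, hr, rfl⟩, h⟩ := (IsLocalization.eq_iff_exists (M.map (C (σ := Fin mv)))
    (MvPolynomial (Fin mv) A)).1 h
  exact ⟨r, hr, by rw [smul_eq_C_mul, smul_eq_C_mul]; exact h⟩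

theorem tl_flat_of_loc {R : Type*} [CommRing R] {mv : ℕ} (I : Ideal (MvPolynomial (Fin mv) R))
    (H : ∀ (m : Ideal R) [m.IsMaximal], Module.Flat (Localization.AtPrime m)
      (MvPolynomial (Fin mv) (Localization.AtPrime m) ⧸
        I.map (map (algebraMap R (Localization.AtPrime m))))) :
    Module.Flat R (MvPolynomial (Fin mv) R ⧸ I) := by
  let f : ∀ (m : Ideal R) [m.IsMaximal], MvPolynomial (Fin mv) R →ₗ[R]
    MvPolynomial (Fin mv) (Localization.AtPrime m) := fun m _ =>
      (IsScalarTower.toAlgHom R (MvPolynomial (Fin mv) R)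
        (MvPolynomial (Fin mv) (Localization.AtPrime m))).toLinearMap
  have hf : ∀ (m : Ideal R) [m.IsMaximal], IsLocalizedModule m.primeCompl (f m) := by
    intro m _
    exact isLocalizedModule_iff_isLocalization.2 (MvPolynomial.isLocalization m.primeCompl _)
  have hJ : ∀ (m : Ideal R) [m.IsMaximal],
      (I.restrictScalars R).localized' (Localization.AtPrime m) m.primeCompl (f m) =
        (I.map (map (algebraMap R (Localization.AtPrime m)))).restrictScalars
          (Localization.AtPrime m) := by
    intro m _
    apply le_antisymm
    · rw [Submodule.localized'_eq_span, Submodule.span_le]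
      rintro _ ⟨x, hx, rfl⟩
      exact Ideal.mem_map_of_mem _ hx
    · intro z hz
      obtain ⟨a, ha, r, hr, h⟩ := tl_mem_map m.primeCompl hz
      refine ⟨a, ha, ⟨r, hr⟩, ?_⟩
      rw [IsLocalizedModule.mk'_eq_iff]
      rw [Submonoid.smul_def, ← algebraMap_smul (Localization.AtPrime m), h]
      rfl
  have hfl : ∀ (m : Ideal R) [m.IsMaximal], Module.Flat R
      (MvPolynomial (Fin mv) (Localization.AtPrime m) ⧸
        (I.restrictScalars R).localized' (Localization.AtPrime m) m.primeCompl (f m)) := by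
    intro m _
    have := H m
    have : Module.Flat (Localization.AtPrime m) (MvPolynomial (Fin mv) (Localization.AtPrime m) ⧸
        (I.restrictScalars R).localized' (Localization.AtPrime m) m.primeCompl (f m)) := by
      rw [hJ m]
      exact Module.Flat.of_linearEquiv (Submodule.Quotient.restrictScalarsEquiv
        (Localization.AtPrime m) (I.map (map (algebraMap R (Localization.AtPrime m)))))
    exact Module.Flat.trans R (Localization.AtPrime m) _
  have := Module.flat_of_isLocalized_maximal (R := R) R (MvPolynomial (Fin mv) R ⧸ I.restrictScalars R)
    (fun m _ => MvPolynomial (Fin mv) (Localization.AtPrime m) ⧸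
        (I.restrictScalars R).localized' (Localization.AtPrime m) m.primeCompl (f m))
    (fun m _ => (I.restrictScalars R).toLocalizedQuotient' (Localization.AtPrime m)
      m.primeCompl (f m)) hfl
  exact Module.Flat.of_linearEquiv (Submodule.Quotient.restrictScalarsEquiv R I).symm

end

theorem tl_loc_H {R A : Type*} [CommRing R] [CommRing A] [Algebra R A] {mv : ℕ}
    (m : Ideal R) [m.IsPrime] [IsLocalization.AtPrime A m] [IsLocalRing A]
    {w : Fin mv → ℕ} {D : ℕ}
    (I : Ideal (MvPolynomial (Fin mv) R))
    (HR : ∀ h ∈ I, h ∈ weightedHomogeneousSubmodule R w D → (∀ e, coeff e h ∈ m) →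
      h ∈ m • (I.restrictScalars R ⊓ weightedHomogeneousSubmodule R w D))
    (h : MvPolynomial (Fin mv) A) (hI : h ∈ I.map (map (algebraMap R A)))
    (hW : h ∈ weightedHomogeneousSubmodule A w D)
    (hm : ∀ e, coeff e h ∈ IsLocalRing.maximalIdeal A) :
    h ∈ IsLocalRing.maximalIdeal A • ((I.map (map (algebraMap R A))).restrictScalars A ⊓
      weightedHomogeneousSubmodule A w D) := by
  obtain ⟨a, ha, r, hr, har⟩ := tl_mem_map m.primeCompl hI
  have hmW : ∀ x ∈ weightedHomogeneousSubmodule R w D,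
      map (algebraMap R A) x ∈ weightedHomogeneousSubmodule A w D := by
    intro x hx e he
    rw [coeff_map] at he
    exact hx (fun h0 => he (by rw [h0, map_zero]))
  have hcomp : map (algebraMap R A) a =
      map (algebraMap R A) (weightedHomogeneousComponent w D a) := by
    ext e
    rw [coeff_map, coeff_map, coeff_weightedHomogeneousComponent]
    split_ifs with he
    · rfl
    · rw [map_zero, ← coeff_map, ← har, coeff_smul]
      by_contra hne
      exact he (hW (fun h0 => hne (by rw [h0, smul_zero])))
  obtain ⟨r', hr', hrr⟩ := tl_map_eq m.primeCompl hcomp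
  have hbI : r' • a ∈ I := by rw [smul_eq_C_mul]; exact I.mul_mem_left _ ha
  have hbW : r' • a ∈ weightedHomogeneousSubmodule R w D := by
    rw [hrr]
    exact Submodule.smul_mem _ _ (weightedHomogeneousComponent_mem w a D)
  have hb : map (algebraMap R A) (r' • a) = algebraMap R A (r' * r) • h := by
    rw [smul_eq_C_mul, map_mul, map_C, ← har, ← smul_eq_C_mul, smul_smul, map_mul]
  have hbm : ∀ e, coeff e (r' • a) ∈ m := by
    intro e
    rw [← IsLocalization.AtPrime.to_map_mem_maximal_iff A m, ← coeff_map, hb, coeff_smul]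
    exact Ideal.mul_mem_left _ _ (hm e)
  have key := HR _ hbI hbW hbm
  have hu : IsUnit (algebraMap R A (r' * r)) :=
    IsLocalization.map_units A (⟨r' * r, m.primeCompl.mul_mem hr' hr⟩ : m.primeCompl)
  have h2 : ∀ x ∈ m • (I.restrictScalars R ⊓ weightedHomogeneousSubmodule R w D),
      map (algebraMap R A) x ∈ IsLocalRing.maximalIdeal A •
        ((I.map (map (algebraMap R A))).restrictScalars A ⊓
          weightedHomogeneousSubmodule A w D) := by
    intro x hx
    refine Submodule.smul_induction_on hx ?_ ?_
    · intro c hc y hy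
      rw [smul_eq_C_mul, map_mul, map_C, ← smul_eq_C_mul]
      exact Submodule.smul_mem_smul ((IsLocalization.AtPrime.to_map_mem_maximal_iff A m c).2 hc)
        ⟨Ideal.mem_map_of_mem _ hy.1, hmW y hy.2⟩
    · intro x y hx hy
      rw [map_add]; exact add_mem hx hy
  have h3 := h2 _ key
  rw [hb] at h3
  obtain ⟨u, hu⟩ := hu
  rw [← hu] at h3
  have := Submodule.smul_mem _ (u⁻¹).1 h3
  rwa [smul_smul, Units.inv_mul, one_smul] at this

/-- Let `I ⊆ R[𝔛]` be a twisted-linear ideal generated by twisted-linear elements of degree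
`≤ p^n` (i.e. lying in `FPV_l(R)` with `l ≤ n`), and assume that the homogeneous component
`(R[𝔛]/I)_dd` is `R`-flat for every degree `dd ≤ p^n`. Then `R[𝔛]/I` is `R`-flat. -/
theorem flat_of_components_flat
    (p : ℕ) (hp : p.Prime) (R : Type*) [CommRing R] [CharP R p]
    (mv : ℕ) (d : Fin mv → ℕ) (n : ℕ) (I : Ideal (MvPolynomial (Fin mv) R))
    (htl : ∃ s : Finset (MvPolynomial (Fin mv) R),
      (∀ f ∈ s, ∃ l : ℕ, l ≤ n ∧ f ∈ FPV p R mv d l) ∧ I = Ideal.span s)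
    (hcomp : ∀ dd : ℕ, dd ≤ p ^ n →
      Module.Flat R
        (↥(weightedHomogeneousSubmodule R (fun i => p ^ d i) dd) ⧸
          Submodule.comap (weightedHomogeneousSubmodule R (fun i => p ^ d i) dd).subtype
            (I.restrictScalars R))) :
    Module.Flat R (MvPolynomial (Fin mv) R ⧸ I) := by
  classical
  obtain ⟨s, hs, rfl⟩ := htl
  refine tl_flat_of_loc _ fun m hm => ?_
  have hpA : CharP (Localization.AtPrime m) p := by
    rw [CharP.charP_iff_prime_eq_zero hp, ← map_natCast (algebraMap R (Localization.AtPrime m)),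
      CharP.cast_eq_zero, map_zero]
  have hJ : (Ideal.span (s : Set (MvPolynomial (Fin mv) R))).map
      (map (algebraMap R (Localization.AtPrime m))) = Ideal.span
        ((s.image (map (algebraMap R (Localization.AtPrime m))) : Finset _) :
          Set (MvPolynomial (Fin mv) (Localization.AtPrime m))) := by
    rw [Ideal.map_span, Finset.coe_image]
  rw [hJ]
  refine tl_local (d := d) hp n _ ?_ ?_
  · intro f hf
    obtain ⟨g, hg, rfl⟩ := Finset.mem_image.1 hf
    obtain ⟨l, hl, h⟩ := hs g hg
    exact ⟨l, hl, tl_map_FPV h⟩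
  · rw [← hJ]
    intro k hk h hI hW hc
    refine tl_loc_H m _ ?_ h hI hW hc
    intro x hx hxW hxm
    have := hcomp (p ^ k) (Nat.pow_le_pow_right hp.pos hk)
    exact tl_flat_crit _ m x hx hxW hxm
end

section
/- Let p be a prime, R a commutative ring of characteristic p, and R[𝔛] the graded polynomial ring in variables x_1,…,x_m with deg x_i = p^{d_i}. Let I ⊆ R[𝔛] be a twisted-linear ideal generated by twisted-linear elements of degree ≤ p^n. If the homogeneous components (R[𝔛]/I)_{p^i} are flat over R for i = 0, 1, …, n, then R[𝔛]/I is flat over R. -/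
open MvPolynomial

namespace TwLin

/-- the twisted-linear polynomial of level `l` with coefficient vector `v` -/
noncomputable def phi {R : Type*} [CommRing R] {σ : Type*} [Fintype σ] (p : ℕ) (d : σ → ℕ) (l : ℕ)
    (v : σ → R) : MvPolynomial σ R := ∑ i, C (v i) * X i ^ p ^ (l - d i)

/-- ideal generated by a set of twisted-linear data -/
noncomputable def Id {R : Type*} [CommRing R] {σ : Type*} [Fintype σ] (p : ℕ) (d : σ → ℕ)
    (s : Set (ℕ × (σ → R))) : Ideal (MvPolynomial σ R) :=
  Ideal.span ((fun x => phi p d x.1 x.2) '' s)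

lemma comp_monomial {R σ : Type*} [CommRing R] (w : σ → ℕ) (n : ℕ) (a : σ →₀ ℕ) (r : R) :
    weightedHomogeneousComponent w n (monomial a r) =
      if Finsupp.weight w a = n then monomial a r else 0 := by
  have h : monomial a r ∈ weightedHomogeneousSubmodule R w (Finsupp.weight w a) := by
    rw [mem_weightedHomogeneousSubmodule]
    exact isWeightedHomogeneous_monomial w a r rfl
  rw [weightedHomogeneousComponent_of_mem h]
  simp only [eq_comm]

lemma comp_rename {R σ τ : Type*} [CommRing R] (w : σ → ℕ) (e : τ → σ) (n : ℕ)
    (h : MvPolynomial τ R) :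
    weightedHomogeneousComponent w n (rename e h) =
      rename e (weightedHomogeneousComponent (fun i => w (e i)) n h) := by
  induction h using MvPolynomial.induction_on' with
  | monomial a r =>
    rw [rename_monomial, comp_monomial, comp_monomial]
    have : Finsupp.weight w (Finsupp.mapDomain e a) = Finsupp.weight (fun i => w (e i)) a := by
      simp only [Finsupp.weight_apply]
      rw [Finsupp.sum_mapDomain_index] <;> simp [add_mul]
    rw [this]
    split_ifs <;> simp [rename_monomial]
  | add f g hf hg => simp only [map_add, hf, hg]

lemma comp_map {R S σ : Type*} [CommRing R] [CommRing S] (k : R →+* S) (w : σ → ℕ) (n : ℕ)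
    (h : MvPolynomial σ R) :
    weightedHomogeneousComponent w n (map k h) =
      map k (weightedHomogeneousComponent w n h) := by
  ext a
  classical
  simp only [coeff_weightedHomogeneousComponent, coeff_map]
  split_ifs <;> simp

section
variable {R : Type*} [CommRing R] {σ : Type*} [Fintype σ] {p : ℕ} {d : σ → ℕ}

lemma phi_hom {l : ℕ} {v : σ → R} (hv : ∀ i, l < d i → v i = 0) :
    IsWeightedHomogeneous (fun k => p ^ d k) (phi p d l v) (p ^ l) := by
  apply IsWeightedHomogeneous.sum
  intro i _
  by_cases h : l < d i
  · rw [hv i h]; simp only [map_zero, zero_mul]; exact isWeightedHomogeneous_zero _ _ _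
  · have := (((isWeightedHomogeneous_X R (fun k => p ^ d k) i).pow (p ^ (l - d i))).C_mul (v i))
    convert this using 1
    simp only [smul_eq_mul]
    rw [← pow_add]; congr 1; omega

lemma phi_add (l : ℕ) (u v : σ → R) : phi p d l (u + v) = phi p d l u + phi p d l v := by
  simp [phi, add_mul, Finset.sum_add_distrib]

lemma phi_smul (l : ℕ) (c : R) (v : σ → R) : phi p d l (c • v) = C c * phi p d l v := by
  simp [phi, Finset.mul_sum, mul_assoc]

lemma phi_zero (l : ℕ) : phi p d l (0 : σ → R) = 0 := by
  simp [phi]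

lemma phi_frob [Fact p.Prime] [CharP R p] {l : ℕ} {v : σ → R} (hv : ∀ i, l < d i → v i = 0)
    (k : ℕ) : phi p d (l + k) (fun i => v i ^ p ^ k) = phi p d l v ^ p ^ k := by
  have hp : p ≠ 0 := (Fact.out : p.Prime).ne_zero
  unfold phi
  rw [sum_pow_char_pow]
  refine Finset.sum_congr rfl fun i _ => ?_
  by_cases h : l < d i
  · simp [hv i h, hp]
  · rw [mul_pow, ← pow_mul, ← pow_add, C_pow]
    congr 3; omega

lemma phi_map {S : Type*} [CommRing S] (k : R →+* S) (l : ℕ) (v : σ → R) :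
    map k (phi p d l v) = phi p d l (fun i => k (v i)) := by
  simp [phi]

lemma phi_rename [DecidableEq σ] (j : σ) (l : ℕ) (v : σ → R) :
    phi p d l v = C (v j) * X j ^ p ^ (l - d j) +
      rename (Subtype.val : {i // i ≠ j} → σ)
        (phi p (fun i : {i // i ≠ j} => d i) l (fun i : {i // i ≠ j} => v i)) := by
  simp only [phi, map_sum, map_mul, map_pow, rename_C, rename_X]
  rw [← Finset.add_sum_erase _ _ (Finset.mem_univ j)]
  congr 1
  rw [← Finset.sum_subtype (Finset.univ.erase j) (p := fun i => i ≠ j) (by simp)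
    (f := fun i => C (v i) * X i ^ p ^ (l - d i))]

end

/-- commuting a homogeneous component with multiplication by a homogeneous element -/
lemma comp_mul {R σ : Type*} [CommRing R] (w : σ → ℕ) {m n : ℕ} (a f : MvPolynomial σ R)
    (hf : IsWeightedHomogeneous w f m) :
    weightedHomogeneousComponent w n (a * f) =
      if m ≤ n then weightedHomogeneousComponent w (n - m) a * f else 0 := by
  induction a using MvPolynomial.induction_on' with
  | monomial a r =>
    have h : monomial a r * f ∈ weightedHomogeneousSubmodule R w (Finsupp.weight w a + m) := by
      rw [mem_weightedHomogeneousSubmodule]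
      exact (isWeightedHomogeneous_monomial w a r rfl).mul hf
    rw [weightedHomogeneousComponent_of_mem h, comp_monomial]
    split_ifs <;> first | rfl | omega
  | add f g hf hg => 
    simp only [add_mul, map_add, hf, hg]
    split_ifs <;> simp

end TwLin

namespace TwLin

lemma phi_inj {R : Type*} [CommRing R] {σ : Type*} [Fintype σ] {p : ℕ} {d : σ → ℕ} (hp : p.Prime)
    {l : ℕ} {v : σ → R} (h : phi p d l v = 0) : v = 0 := by
  classical
  funext i
  have h1 : coeff (Finsupp.single i (p ^ (l - d i))) (phi p d l v) = 0 := by rw [h]; simp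
  unfold phi at h1
  rw [coeff_sum, Finset.sum_eq_single i] at h1
  · rw [coeff_C_mul, coeff_X_pow, if_pos rfl] at h1
    simpa using h1
  · intro k _ hk
    rw [coeff_C_mul, coeff_X_pow, if_neg, mul_zero]
    intro h2
    have h3 := DFunLike.congr_fun h2 i
    rw [Finsupp.single_eq_same, Finsupp.single_eq_of_ne (by exact fun h => hk h.symm)] at h3
    exact (pow_pos hp.pos _).ne' h3.symm
  · simp

lemma exists_pivot {R : Type*} [CommRing R] [IsLocalRing R] {σ : Type*} [Fintype σ] {p : ℕ}
    {d : σ → ℕ} (hp : p.Prime) {s : Set (ℕ × (σ → R))} (hs : s.Finite)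
    (hsupp : ∀ x ∈ s, ∀ i, x.1 < d i → x.2 i = 0) {l : ℕ}
    (hlow : ∀ x ∈ s, x.1 < l → x.2 = 0) (hex : ∃ x ∈ s, x.1 = l ∧ x.2 ≠ 0)
    (π : MvPolynomial σ R →ₗ[R] MvPolynomial σ R) (hπ : ∀ h, π h ∈ Id p d s)
    (hπ' : ∀ h ∈ Id p d s, π h = weightedHomogeneousComponent (fun k => p ^ d k) (p ^ l) h) :
    ∃ x ∈ s, x.1 = l ∧ ∃ j, IsUnit (x.2 j) := by
  by_contra hcon
  push Not at hcon
  set w : σ → ℕ := fun k => p ^ d k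
  let U : Submodule R (MvPolynomial σ R) :=
    Submodule.span R ((fun x => phi p d x.1 x.2) '' {x ∈ s | x.1 = l})
  have hfg : U.FG := Submodule.fg_span ((hs.subset (Set.sep_subset _ _)).image _)
  have hU : ∀ h ∈ Id p d s, weightedHomogeneousComponent w (p ^ l) h ∈ U := by
    intro h hh
    suffices ∀ a, weightedHomogeneousComponent w (p ^ l) (a * h) ∈ U by simpa using this 1
    refine Submodule.span_induction ?_ ?_ ?_ ?_ hh
    · rintro _ ⟨x, hx, rfl⟩ a
      dsimp only
      rw [comp_mul w a _ (phi_hom (hsupp x hx))]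
      rcases lt_trichotomy x.1 l with h1 | h1 | h1
      · rw [hlow x hx h1, phi_zero]; simp
      · rw [if_pos (by rw [h1]), h1, Nat.sub_self, weightedHomogeneousComponent_zero _ (by
          intro i; exact (pow_pos hp.pos _).ne'), ← smul_eq_C_mul]
        exact U.smul_mem _ (Submodule.subset_span ⟨x, ⟨hx, h1⟩, by simp [h1]⟩)
      · rw [if_neg]
        · exact U.zero_mem
        · exact not_le.mpr (Nat.pow_lt_pow_right hp.one_lt h1)
    · intro a; simp
    · intro f g _ _ hf hg a
      rw [mul_add, map_add]; exact U.add_mem (hf a) (hg a)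
    · intro b f _ hf a
      rw [smul_eq_mul, ← mul_assoc]; exact hf _
  have hle : U ≤ IsLocalRing.maximalIdeal R • U := by
    refine Submodule.span_le.mpr ?_
    rintro _ ⟨x, ⟨hx, hxl⟩, rfl⟩
    dsimp only
    have hmem : phi p d x.1 x.2 ∈ Id p d s := Ideal.subset_span ⟨x, hx, rfl⟩
    have h1 : weightedHomogeneousComponent w (p ^ l) (phi p d x.1 x.2) = phi p d x.1 x.2 := by
      have := phi_hom (p := p) (hsupp x hx)
      rw [hxl] at this ⊢
      exact this.weightedHomogeneousComponent_same
    have h2 : phi p d x.1 x.2 =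
        weightedHomogeneousComponent w (p ^ l) (π (phi p d x.1 x.2)) := by
      rw [hπ' _ hmem, h1, h1]
    have h3 : weightedHomogeneousComponent w (p ^ l) (π (phi p d x.1 x.2)) =
        ∑ i, x.2 i • weightedHomogeneousComponent w (p ^ l) (π (X i ^ p ^ (x.1 - d i))) := by
      simp only [phi, ← smul_eq_C_mul, map_sum, map_smul]
    rw [SetLike.mem_coe, h2, h3]
    refine Submodule.sum_mem _ fun i _ => Submodule.smul_mem_smul ?_ (hU _ (hπ _))
    exact (IsLocalRing.mem_maximalIdeal _).mpr (hcon x hx hxl i)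
  have hbot := Submodule.eq_bot_of_le_smul_of_le_jacobson_bot _ U hfg hle
    (IsLocalRing.maximalIdeal_le_jacobson _)
  obtain ⟨x, hx, hxl, hne⟩ := hex
  apply hne
  apply phi_inj hp (l := x.1) (d := d)
  have : phi p d x.1 x.2 ∈ U := Submodule.subset_span ⟨x, ⟨hx, hxl⟩, rfl⟩
  rw [hbot] at this
  simpa using this

/-- coefficient-zero reduction modulo a monic relation -/
lemma exists_rho {R : Type*} [CommRing R] {σ : Type*} [DecidableEq σ] (j : σ) (q : ℕ) (hq : 0 < q)
    (g : MvPolynomial {i // i ≠ j} R) (J : Ideal (MvPolynomial {i // i ≠ j} R)) :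
    ∃ ρ : MvPolynomial σ R →ₗ[R] MvPolynomial {i // i ≠ j} R,
      (∀ h, ρ (rename Subtype.val h) = h) ∧
      ∀ h ∈ Ideal.span {X j ^ q - rename Subtype.val g} ⊔ J.map (rename (R := R) Subtype.val),
        ρ h ∈ J := by
  let T := MvPolynomial {i // i ≠ j} R
  let P : MvPolynomial σ R →ₐ[R] Polynomial T :=
    aeval (fun i => if h : i = j then Polynomial.X else Polynomial.C (X ⟨i, h⟩))
  have hPι : ∀ h : T, P (rename Subtype.val h) = Polynomial.C h := by
    intro h
    have : P.comp (rename (R := R) Subtype.val) = Polynomial.CAlgHom (R := R) (A := T) := by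
      ext i
      simp [P, i.2]
    exact DFunLike.congr_fun this h
  have hPj : P (X j) = Polynomial.X := by simp [P]
  have hmon : (Polynomial.X ^ q - Polynomial.C g : Polynomial T).Monic :=
    Polynomial.monic_X_pow_sub_C g hq.ne'
  let F : Polynomial T := Polynomial.X ^ q - Polynomial.C g
  let ρ₀ : Polynomial T →ₗ[T] T := (Polynomial.lcoeff T 0) ∘ₗ Polynomial.modByMonicHom F
  have hρC : ∀ h : T, ρ₀ (Polynomial.C h) = h := by
    intro h
    rcases subsingleton_or_nontrivial T with hT | hT
    · exact Subsingleton.elim _ _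
    simp only [ρ₀, LinearMap.comp_apply, Polynomial.modByMonicHom_apply, Polynomial.lcoeff_apply]
    rw [(Polynomial.modByMonic_eq_self_iff hmon).mpr, Polynomial.coeff_C_zero]
    refine Polynomial.degree_C_le.trans_lt ?_
    rw [Polynomial.degree_X_pow_sub_C hq]
    exact_mod_cast hq
  have hρF : ∀ a, ρ₀ (a * F) = 0 := by
    intro a
    simp only [ρ₀, LinearMap.comp_apply, Polynomial.modByMonicHom_apply, Polynomial.lcoeff_apply]
    rw [(Polynomial.modByMonic_eq_zero_iff_dvd hmon).mpr (Dvd.intro_left _ rfl)]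
    simp
  refine ⟨(ρ₀.restrictScalars R) ∘ₗ P.toLinearMap, ?_, ?_⟩
  · intro h
    simp only [LinearMap.comp_apply, AlgHom.toLinearMap_apply, hPι, LinearMap.restrictScalars_apply,
      hρC]
  · intro h hh
    simp only [LinearMap.comp_apply, AlgHom.toLinearMap_apply, LinearMap.restrictScalars_apply]
    obtain ⟨y, hy, z, hz, rfl⟩ := Submodule.mem_sup.mp hh
    rw [map_add, map_add]
    refine J.add_mem ?_ ?_
    · obtain ⟨a, rfl⟩ := Ideal.mem_span_singleton'.mp hy
      rw [map_mul, map_sub, map_pow, hPj, hPι, hρF]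
      exact J.zero_mem
    · refine Submodule.span_induction ?_ ?_ ?_ ?_ (show z ∈ Submodule.span _ _ from hz) |>
        fun (h : ∀ a, ρ₀ (P (a * z)) ∈ J) => by simpa using h 1
      · rintro _ ⟨x, hx, rfl⟩ a
        have : P (rename Subtype.val x) = Polynomial.C x := hPι x
        change ρ₀ (P (a * rename Subtype.val x)) ∈ J
        rw [map_mul, this, mul_comm, ← Polynomial.smul_eq_C_mul, map_smul, smul_eq_mul]
        exact J.mul_mem_right _ hx
      · intro a; simp
      · intro f g _ _ hf hg a
        rw [mul_add, map_add, map_add]; exact J.add_mem (hf a) (hg a)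
      · intro b f _ hf a
        rw [smul_eq_mul, ← mul_assoc]; exact hf _

/-- flatness of a monic one-variable extension -/
lemma flat_ext {R : Type*} [CommRing R] {σ : Type*} [DecidableEq σ] (j : σ) (q : ℕ) (hq : 0 < q)
    (g : MvPolynomial {i // i ≠ j} R) (J : Ideal (MvPolynomial {i // i ≠ j} R))
    [Module.Flat R (MvPolynomial {i // i ≠ j} R ⧸ J)] (I : Ideal (MvPolynomial σ R))
    (hI : I = Ideal.span {X j ^ q - rename Subtype.val g} ⊔ J.map (rename (R := R) Subtype.val)) :
    Module.Flat R (MvPolynomial σ R ⧸ I) := by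
  let B := MvPolynomial {i // i ≠ j} R ⧸ J
  let mkJ : MvPolynomial {i // i ≠ j} R →ₐ[R] B := Ideal.Quotient.mkₐ R J
  let F : Polynomial B := Polynomial.X ^ q - Polynomial.C (mkJ g)
  have hmon : F.Monic := Polynomial.monic_X_pow_sub_C _ hq.ne'
  have := hmon.free_adjoinRoot
  have : Module.Flat R (AdjoinRoot F) := Module.Flat.trans R B (AdjoinRoot F)
  let ofB : B →ₐ[R] AdjoinRoot F := IsScalarTower.toAlgHom R B (AdjoinRoot F)
  have hof : ∀ b, ofB b = AdjoinRoot.of F b := fun b => rfl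
  let Φ₀ : MvPolynomial σ R →ₐ[R] AdjoinRoot F :=
    aeval (fun i => if h : i = j then AdjoinRoot.root F else ofB (mkJ (X ⟨i, h⟩)))
  have hΦj : Φ₀ (X j) = AdjoinRoot.root F := by simp [Φ₀]
  have hΦι : ∀ h, Φ₀ (rename Subtype.val h) = ofB (mkJ h) := by
    intro h
    have : Φ₀.comp (rename (R := R) Subtype.val) = ofB.comp mkJ := by
      ext i
      simp [Φ₀, i.2]
    exact DFunLike.congr_fun this h
  have hroot : AdjoinRoot.root F ^ q = ofB (mkJ g) := by
    have := AdjoinRoot.eval₂_root F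
    simp only [F, Polynomial.eval₂_sub, Polynomial.eval₂_pow, Polynomial.eval₂_X,
      Polynomial.eval₂_C] at this
    exact sub_eq_zero.mp this
  have hker : I ≤ RingHom.ker Φ₀ := by
    rw [hI]
    refine sup_le ?_ ?_
    · rw [Ideal.span_singleton_le_iff_mem, RingHom.mem_ker, map_sub, map_pow, hΦj, hΦι, hroot,
        sub_self]
    · refine Ideal.map_le_iff_le_comap.mpr fun x hx => ?_
      rw [Ideal.mem_comap, RingHom.mem_ker]
      refine (hΦι x).trans ?_
      have : mkJ x = 0 := Ideal.Quotient.eq_zero_iff_mem.mpr hx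
      rw [this, map_zero]
  let Φ : (MvPolynomial σ R ⧸ I) →ₐ[R] AdjoinRoot F := Ideal.Quotient.liftₐ I Φ₀ hker
  let mkI : MvPolynomial σ R →ₐ[R] (MvPolynomial σ R ⧸ I) := Ideal.Quotient.mkₐ R I
  have hJ : ∀ x ∈ J, (mkI.comp (rename (R := R) Subtype.val)) x = 0 := by
    intro x hx
    refine Ideal.Quotient.eq_zero_iff_mem.mpr ?_
    rw [hI]
    exact Ideal.mem_sup_right (Ideal.mem_map_of_mem _ hx)
  let ψ : B →ₐ[R] (MvPolynomial σ R ⧸ I) := Ideal.Quotient.liftₐ J _ hJ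
  have hψ : ∀ h, ψ (mkJ h) = mkI (rename Subtype.val h) := fun h => rfl
  let Ψ₀ : AdjoinRoot F →+* (MvPolynomial σ R ⧸ I) := AdjoinRoot.lift ψ.toRingHom (mkI (X j)) (by
    simp only [F, Polynomial.eval₂_sub, Polynomial.eval₂_pow, Polynomial.eval₂_X,
      Polynomial.eval₂_C]
    change _ - ψ (mkJ g) = 0
    rw [hψ, ← map_pow, ← map_sub]
    refine Ideal.Quotient.eq_zero_iff_mem.mpr ?_
    rw [hI]
    exact Ideal.mem_sup_left (Ideal.mem_span_singleton_self _))
  have hΨof : ∀ b, Ψ₀ (ofB b) = ψ b := fun b => AdjoinRoot.lift_of _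
  let Ψ : AdjoinRoot F →ₐ[R] (MvPolynomial σ R ⧸ I) :=
    { Ψ₀ with
      commutes' := fun r => by
        change Ψ₀ (algebraMap R _ r) = _
        rw [← ofB.commutes, hΨof, ψ.commutes] }
  have hcomp : Ψ.comp Φ = AlgHom.id R _ := by
    apply Ideal.Quotient.algHom_ext
    apply MvPolynomial.algHom_ext
    intro i
    change Ψ₀ (Φ₀ (X i)) = mkI (X i)
    by_cases h : i = j
    · subst h
      rw [hΦj]
      exact AdjoinRoot.lift_root _
    · have : Φ₀ (X i) = ofB (mkJ (X ⟨i, h⟩)) := by simp [Φ₀, h]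
      rw [this, hΨof, hψ, rename_X]
  exact Module.Flat.of_retract Φ.toLinearMap Ψ.toLinearMap
    (by rw [← AlgHom.comp_toLinearMap, hcomp]; rfl)

end TwLin

namespace TwLin

theorem flat_local {R : Type*} [CommRing R] [IsLocalRing R] {p : ℕ} (hp : p.Prime) [CharP R p]
    (n : ℕ) (N : ℕ) : ∀ (σ : Type) [Fintype σ] [DecidableEq σ] (_ : Fintype.card σ = N)
    (d : σ → ℕ) (s : Set (ℕ × (σ → R))) (_ : s.Finite)
    (_ : ∀ x ∈ s, ∀ i, x.1 < d i → x.2 i = 0) (_ : ∀ x ∈ s, x.1 ≤ n)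
    (_ : ∀ l ≤ n, ∃ π : MvPolynomial σ R →ₗ[R] MvPolynomial σ R,
      (∀ h, π h ∈ Id p d s) ∧
      ∀ h ∈ Id p d s, π h = weightedHomogeneousComponent (fun k => p ^ d k) (p ^ l) h),
    Module.Flat R (MvPolynomial σ R ⧸ Id p d s) := by
  have : Fact p.Prime := ⟨hp⟩
  induction N with
  | zero =>
    intro σ _ _ hcard d s hs hsupp hn hπ
    have : IsEmpty σ := Fintype.card_eq_zero_iff.mp hcard
    have h0 : Id p d s = ⊥ := by
      refine Ideal.span_eq_bot.mpr ?_
      rintro _ ⟨x, hx, rfl⟩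
      simp [phi]
    rw [h0]
    exact Module.Flat.of_linearEquiv (AlgEquiv.quotientBot R (MvPolynomial σ R)).toLinearEquiv
  | succ N ih =>
    intro σ _ _ hcard d s hs hsupp hn hπ
    by_cases hz : ∀ x ∈ s, x.2 = 0
    · have h0 : Id p d s = ⊥ := by
        refine Ideal.span_eq_bot.mpr ?_
        rintro _ ⟨x, hx, rfl⟩
        simp [hz x hx, phi_zero]
      rw [h0]
      exact Module.Flat.of_linearEquiv (AlgEquiv.quotientBot R (MvPolynomial σ R)).toLinearEquiv
    push Not at hz
    have hex : ∃ l, ∃ x ∈ s, x.1 = l ∧ x.2 ≠ 0 := by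
      obtain ⟨x, hx, hx0⟩ := hz
      exact ⟨x.1, x, hx, rfl, hx0⟩
    classical
    let l := Nat.find hex
    have hl : ∃ x ∈ s, x.1 = l ∧ x.2 ≠ 0 := Nat.find_spec hex
    have hlow : ∀ x ∈ s, x.1 < l → x.2 = 0 := by
      intro x hx hxl
      by_contra h0
      exact Nat.find_min hex hxl ⟨x, hx, rfl, h0⟩
    have hln : l ≤ n := by
      obtain ⟨x, hx, h1, _⟩ := hl
      exact h1 ▸ hn x hx
    obtain ⟨π, h1, h2⟩ := hπ l hln
    obtain ⟨x₀, hx₀, hx₀l, j, hu⟩ := exists_pivot hp hs hsupp hlow hl π h1 h2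
    obtain ⟨c, hc⟩ := hu.exists_left_inv
    let w : σ → R := c • x₀.2
    have hwj : w j = 1 := hc
    have hwsupp : ∀ i, l < d i → w i = 0 := by
      intro i hi
      have := hsupp x₀ hx₀ i (by omega)
      simp [w, this]
    let τ := {i // i ≠ j}
    let d' : τ → ℕ := fun i => d i
    let red : ℕ × (σ → R) → (σ → R) := fun x => x.2 - x.2 j • (fun i => w i ^ p ^ (x.1 - l))
    let r : ℕ × (σ → R) → ℕ × (τ → R) := fun x => (x.1, fun i => red x i)
    let s' : Set (ℕ × (τ → R)) := r '' s
    have hredj : ∀ x, red x j = 0 := by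
      intro x
      simp [red, hwj]
    let q := p ^ (l - d j)
    let g : MvPolynomial τ R := - phi p d' l (fun i : τ => w i)
    have hf₀ : phi p d l w = X j ^ q - rename Subtype.val g := by
      rw [phi_rename j, hwj]
      simp [g, q, d', τ]
    have hf₀I : phi p d l w ∈ Id p d s := by
      have : phi p d l w = C c * phi p d x₀.1 x₀.2 := by rw [hx₀l]; exact phi_smul _ _ _
      rw [this]
      exact Ideal.mul_mem_left _ _ (Ideal.subset_span ⟨x₀, hx₀, rfl⟩)
    have hred : ∀ x, rename Subtype.val (phi p d' (r x).1 (r x).2) = phi p d x.1 (red x) := by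
      intro x
      rw [phi_rename j x.1 (red x), hredj]
      simp [r, d', τ]
    -- decomposition of generators
    have hdec : ∀ x ∈ s, ∃ a, phi p d x.1 x.2 = a * phi p d l w + phi p d x.1 (red x) := by
      intro x hx
      by_cases hxl : x.1 < l
      · refine ⟨0, ?_⟩
        have h0 := hlow x hx hxl
        have : red x = x.2 := by simp [red, h0]
        rw [this, zero_mul, zero_add]
      · have e : x.2 = x.2 j • (fun i => w i ^ p ^ (x.1 - l)) + red x := by simp [red]
        have e2 : l + (x.1 - l) = x.1 := by omega
        have e3 := phi_frob (p := p) hwsupp (x.1 - l)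
        rw [e2] at e3
        refine ⟨C (x.2 j) * phi p d l w ^ (p ^ (x.1 - l) - 1), ?_⟩
        conv_lhs => rw [e, phi_add, phi_smul, e3]
        rw [mul_assoc, ← pow_succ, Nat.sub_add_cancel (Nat.one_le_pow _ _ hp.pos)]
    have hI : Id p d s = Ideal.span {X j ^ q - rename Subtype.val g} ⊔
        (Id p d' s').map (rename (R := R) Subtype.val) := by
      rw [← hf₀]
      apply le_antisymm
      · refine Ideal.span_le.mpr ?_
        rintro _ ⟨x, hx, rfl⟩
        obtain ⟨a, ha⟩ := hdec x hx
        dsimp only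
        rw [ha, ← hred]
        refine Ideal.add_mem _ (Ideal.mem_sup_left
          (Ideal.mul_mem_left _ _ (Ideal.mem_span_singleton_self _))) (Ideal.mem_sup_right ?_)
        exact Ideal.mem_map_of_mem _ (Ideal.subset_span ⟨r x, ⟨x, hx, rfl⟩, rfl⟩)
      · refine sup_le ((Ideal.span_singleton_le_iff_mem _).mpr hf₀I) ?_
        rw [Ideal.map_le_iff_le_comap]
        refine Ideal.span_le.mpr ?_
        rintro _ ⟨_, ⟨x, hx, rfl⟩, rfl⟩
        change rename Subtype.val (phi p d' (r x).1 (r x).2) ∈ Id p d s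
        rw [hred]
        obtain ⟨a, ha⟩ := hdec x hx
        rw [← sub_eq_iff_eq_add'.mpr ha]
        exact Ideal.sub_mem _ (Ideal.subset_span ⟨x, hx, rfl⟩) (Ideal.mul_mem_left _ _ hf₀I)
    have hq : 0 < q := pow_pos hp.pos _
    have hcard' : Fintype.card τ = N := by
      simp [τ, Fintype.card_subtype_compl, hcard]
    have hflat : Module.Flat R (MvPolynomial τ R ⧸ Id p d' s') := by
      refine ih τ hcard' d' s' (hs.image _) ?_ ?_ ?_
      · rintro _ ⟨x, hx, rfl⟩ i hi
        change red x i = 0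
        have hxi := hsupp x hx i hi
        by_cases hxl : x.1 < l
        · simp [red, hlow x hx hxl]
        · have := hwsupp i (lt_of_le_of_lt (not_lt.mp hxl) hi)
          simp [red, hxi, this, hp.ne_zero]
      · rintro _ ⟨x, hx, rfl⟩
        exact hn x hx
      · intro k hk
        obtain ⟨π, h1, h2⟩ := hπ k hk
        obtain ⟨ρ, hρ1, hρ2⟩ := exists_rho j q hq g (Id p d' s')
        refine ⟨ρ ∘ₗ π ∘ₗ (rename (R := R) (Subtype.val : τ → σ)).toLinearMap, ?_, ?_⟩
        · intro h
          exact hρ2 _ (hI ▸ h1 _)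
        · intro h hh
          have hm : rename Subtype.val h ∈ Id p d s := by
            rw [hI]; exact Ideal.mem_sup_right (Ideal.mem_map_of_mem _ hh)
          change ρ (π (rename Subtype.val h)) = _
          rw [h2 _ hm, comp_rename, hρ1]
    exact flat_ext j q hq g (Id p d' s') _ hI

end TwLin

namespace TwLin
open scoped TensorProduct

lemma exists_pi {R : Type*} [CommRing R] {σ : Type*} [Fintype σ] {p : ℕ}
    {d : σ → ℕ} (hp : p.Prime) {s : Set (ℕ × (σ → R))} (hs : s.Finite)
    (hsupp : ∀ x ∈ s, ∀ i, x.1 < d i → x.2 i = 0) (l : ℕ)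
    (hflat : Module.Flat R
        (↥(weightedHomogeneousSubmodule R (fun k => p ^ d k) (p ^ l)) ⧸
          Submodule.comap (weightedHomogeneousSubmodule R (fun k => p ^ d k) (p ^ l)).subtype
            ((Id p d s).restrictScalars R))) :
    ∃ π : MvPolynomial σ R →ₗ[R] MvPolynomial σ R,
      (∀ h, π h ∈ Id p d s) ∧
      ∀ h ∈ Id p d s, π h = weightedHomogeneousComponent (fun k => p ^ d k) (p ^ l) h := by
  set w : σ → ℕ := fun k => p ^ d k with hw
  set H := weightedHomogeneousSubmodule R w (p ^ l) with hH
  set K := Submodule.comap H.subtype ((Id p d s).restrictScalars R) with hK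
  have hwne : ∀ i, w i ≠ 0 := fun i => (pow_pos hp.pos _).ne'
  let cH : MvPolynomial σ R →ₗ[R] H :=
    LinearMap.codRestrict H (weightedHomogeneousComponent w (p ^ l))
      (fun h => weightedHomogeneousComponent_mem w h _)
  have hcH : ∀ h, (cH h : MvPolynomial σ R) = weightedHomogeneousComponent w (p ^ l) h :=
    fun h => rfl
  have hcHid : ∀ v : H, cH v = v := by
    intro v
    apply Subtype.ext
    rw [hcH]
    exact IsWeightedHomogeneous.weightedHomogeneousComponent_same
      ((mem_weightedHomogeneousSubmodule _ _ _ _).mp v.2)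
  have hhom : ∀ h ∈ Id p d s, weightedHomogeneousComponent w (p ^ l) h ∈ Id p d s := by
    intro h hh
    suffices ∀ a, weightedHomogeneousComponent w (p ^ l) (a * h) ∈ Id p d s by simpa using this 1
    refine Submodule.span_induction ?_ ?_ ?_ ?_ hh
    · rintro _ ⟨x, hx, rfl⟩ a
      dsimp only
      rw [comp_mul w a _ (phi_hom (hsupp x hx))]
      split_ifs
      · exact Ideal.mul_mem_left _ _ (Ideal.subset_span ⟨x, hx, rfl⟩)
      · exact Ideal.zero_mem _
    · intro a; simp
    · intro f g _ _ hf hg a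
      rw [mul_add, map_add]; exact Ideal.add_mem _ (hf a) (hg a)
    · intro b f _ hf a
      rw [smul_eq_mul, ← mul_assoc]; exact hf _
  let A : Set (σ →₀ ℕ) := {a | Finsupp.weight w a ≤ p ^ l}
  have hA : A.Finite := Finsupp.finite_of_nat_weight_le w hwne _
  let Z : Submodule R H := Submodule.span R
    ((fun y : (σ →₀ ℕ) × (ℕ × (σ → R)) => cH (monomial y.1 1 * phi p d y.2.1 y.2.2)) '' (A ×ˢ s))
  have hZfg : Z.FG := Submodule.fg_span ((hA.prod hs).image _)
  have hZ : ∀ h ∈ Id p d s, cH h ∈ Z := by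
    intro h hh
    suffices ∀ a, cH (a * h) ∈ Z by simpa using this 1
    refine Submodule.span_induction ?_ ?_ ?_ ?_ hh
    · rintro _ ⟨x, hx, rfl⟩ a
      dsimp only
      induction a using MvPolynomial.induction_on' with
      | monomial a r =>
        by_cases ha : Finsupp.weight w a ≤ p ^ l
        · have : (monomial a r : MvPolynomial σ R) * phi p d x.1 x.2 =
              r • (monomial a 1 * phi p d x.1 x.2) := by
            rw [← smul_mul_assoc, smul_monomial, smul_eq_mul, mul_one]
          rw [this, map_smul]
          exact Z.smul_mem _ (Submodule.subset_span ⟨(a, x), ⟨ha, hx⟩, rfl⟩)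
        · have : cH ((monomial a r : MvPolynomial σ R) * phi p d x.1 x.2) = 0 := by
            apply Subtype.ext
            rw [hcH, comp_mul w _ _ (phi_hom (hsupp x hx)), comp_monomial]
            split_ifs
            · omega
            · simp
            · simp
          rw [this]; exact Z.zero_mem
      | add f g hf hg => rw [add_mul, map_add]; exact Z.add_mem hf hg
    · intro a; simp
    · intro f g _ _ hf hg a
      rw [mul_add, map_add]; exact Z.add_mem (hf a) (hg a)
    · intro b f _ hf a
      rw [smul_eq_mul, ← mul_assoc]; exact hf _
  have hKZ : K = Z := by
    apply le_antisymm
    · intro v hv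
      rw [← hcHid v]
      exact hZ _ hv
    · refine Submodule.span_le.mpr ?_
      rintro _ ⟨⟨a, x⟩, ⟨_, hx⟩, rfl⟩
      exact hhom _ (Ideal.mul_mem_left _ _ (Ideal.subset_span ⟨x, hx, rfl⟩))
  have hfin : Module.Finite R H := Module.Finite.iff_fg.mpr (weightedHomogeneousSubmodule_fg R w hwne _)
  have hproj : Module.Projective R H :=
    Module.Projective.of_split H.subtype cH (LinearMap.ext hcHid)
  have hfp : Module.FinitePresentation R H := Module.finitePresentation_of_projective R H
  have hfpQ : Module.FinitePresentation R (H ⧸ K) :=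
    Module.finitePresentation_of_surjective K.mkQ K.mkQ_surjective (by
      rw [Submodule.ker_mkQ, hKZ]; exact hZfg)
  have hprojQ : Module.Projective R (H ⧸ K) := Module.Flat.projective_of_finitePresentation
  obtain ⟨t, ht⟩ := Module.projective_lifting_property K.mkQ LinearMap.id K.mkQ_surjective
  have ht' : ∀ y, K.mkQ (t y) = y := fun y => DFunLike.congr_fun ht y
  refine ⟨H.subtype ∘ₗ (LinearMap.id - t ∘ₗ K.mkQ) ∘ₗ cH, ?_, ?_⟩
  · intro h
    have : (LinearMap.id - t ∘ₗ K.mkQ : H →ₗ[R] H) (cH h) ∈ K := by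
      refine (Submodule.Quotient.mk_eq_zero K).mp ?_
      rw [← Submodule.mkQ_apply, LinearMap.sub_apply, map_sub,
        LinearMap.comp_apply, ht', LinearMap.id_apply, sub_self]
    exact this
  · intro h hh
    have h0 : K.mkQ (cH h) = 0 := by
      rw [← LinearMap.mem_ker, Submodule.ker_mkQ]
      exact hhom h hh
    simp only [LinearMap.comp_apply, LinearMap.sub_apply, LinearMap.id_apply, h0, map_zero,
      sub_zero]
    rfl

theorem flat_baseChange {R R' : Type*} [CommRing R] [CommRing R'] [Algebra R R']
    {σ : Type*} (I : Ideal (MvPolynomial σ R))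
    [Module.Flat R' (MvPolynomial σ R' ⧸ I.map (map (algebraMap R R')))] :
    Module.Flat R' (TensorProduct R R' (MvPolynomial σ R ⧸ I)) := by
  let I' := I.map (map (σ := σ) (algebraMap R R'))
  let M := MvPolynomial σ R ⧸ I
  let M' := MvPolynomial σ R' ⧸ I'
  let mkI : MvPolynomial σ R →ₐ[R] M := Ideal.Quotient.mkₐ R I
  let mkI' : MvPolynomial σ R' →ₐ[R'] M' := Ideal.Quotient.mkₐ R' I'
  let β₀ : MvPolynomial σ R →ₐ[R] M' :=
    (mkI'.restrictScalars R).comp (mapAlgHom (Algebra.ofId R R'))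
  let β : M →ₐ[R] M' := Ideal.Quotient.liftₐ I β₀ (fun a ha =>
    Ideal.Quotient.eq_zero_iff_mem.mpr (Ideal.mem_map_of_mem _ ha))
  let α : TensorProduct R R' M →ₐ[R'] M' :=
    Algebra.TensorProduct.lift (Algebra.ofId R' M') β (fun _ _ => Commute.all _ _)
  let γ₀ : MvPolynomial σ R' →ₐ[R'] TensorProduct R R' M :=
    aeval (R := R') (S₁ := TensorProduct R R' M)
      (fun i => Algebra.TensorProduct.includeRight (R := R) (A := R') (B := M) (mkI (X i)))
  have hγ₀ : ∀ h, γ₀ (map (algebraMap R R') h) =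
      Algebra.TensorProduct.includeRight (mkI h) := by
    intro h
    have : (γ₀.restrictScalars R).comp (mapAlgHom (Algebra.ofId R R')) =
        Algebra.TensorProduct.includeRight.comp mkI := by
      apply MvPolynomial.algHom_ext
      intro i
      simp [γ₀]
    exact DFunLike.congr_fun this h
  have hker : I' ≤ RingHom.ker γ₀ := by
    refine Ideal.map_le_iff_le_comap.mpr fun x hx => ?_
    rw [Ideal.mem_comap, RingHom.mem_ker]
    refine (hγ₀ x).trans ?_
    have : mkI x = 0 := Ideal.Quotient.eq_zero_iff_mem.mpr hx
    rw [this, map_zero]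
  let γ : M' →ₐ[R'] TensorProduct R R' M := Ideal.Quotient.liftₐ I' γ₀ hker
  have hcomp : γ.comp α = AlgHom.id R' _ := by
    apply Algebra.TensorProduct.ext
    · ext
    · apply Ideal.Quotient.algHom_ext
      apply MvPolynomial.algHom_ext
      intro i
      change γ (α (1 ⊗ₜ[R] mkI (X i))) = 1 ⊗ₜ[R] mkI (X i)
      have : α (1 ⊗ₜ[R] mkI (X i)) = mkI' (map (algebraMap R R') (X i)) := by
        simp only [α, Algebra.TensorProduct.lift_tmul, map_one, one_mul]
        rfl
      rw [this]
      exact hγ₀ (X i)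
  have : Module.Flat R' M' := ‹_›
  exact Module.Flat.of_retract α.toLinearMap γ.toLinearMap
    (by rw [← AlgHom.comp_toLinearMap, hcomp]; rfl)

theorem flat_global {R : Type*} [CommRing R] {p : ℕ} (hp : p.Prime) [CharP R p]
    (n : ℕ) (σ : Type) [Fintype σ] [DecidableEq σ]
    (d : σ → ℕ) (s : Set (ℕ × (σ → R))) (hs : s.Finite)
    (hsupp : ∀ x ∈ s, ∀ i, x.1 < d i → x.2 i = 0) (hn : ∀ x ∈ s, x.1 ≤ n)
    (hπ : ∀ l ≤ n, ∃ π : MvPolynomial σ R →ₗ[R] MvPolynomial σ R,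
      (∀ h, π h ∈ Id p d s) ∧
      ∀ h ∈ Id p d s, π h = weightedHomogeneousComponent (fun k => p ^ d k) (p ^ l) h) :
    Module.Flat R (MvPolynomial σ R ⧸ Id p d s) := by
  refine Module.flat_of_isLocalized_maximal (R := R) R (MvPolynomial σ R ⧸ Id p d s)
    (fun P _ => TensorProduct R (Localization.AtPrime P) (MvPolynomial σ R ⧸ Id p d s))
    (fun P _ => TensorProduct.mk R (Localization.AtPrime P) _ 1) fun P _ => ?_
  let R' := Localization.AtPrime P
  let k : R →+* R' := algebraMap R R'
  have hchar : CharP R' p := (CharP.charP_iff_prime_eq_zero hp).mpr (by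
    rw [← map_natCast k, CharP.cast_eq_zero, map_zero])
  let s' : Set (ℕ × (σ → R')) := (fun x => (x.1, fun i => k (x.2 i))) '' s
  have hI : (Id p d s).map (map k) = Id p d s' := by
    unfold Id
    rw [Ideal.map_span, Set.image_image, Set.image_image]
    simp only [phi_map]
  have key : Module.Flat R' (MvPolynomial σ R' ⧸ Id p d s') := by
    refine flat_local hp n _ σ rfl d s' (hs.image _) ?_ ?_ ?_
    · rintro _ ⟨x, hx, rfl⟩ i hi
      simp [hsupp x hx i hi]
    · rintro _ ⟨x, hx, rfl⟩
      exact hn x hx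
    · intro l hl
      obtain ⟨π, h1, h2⟩ := hπ l hl
      let π' : MvPolynomial σ R' →ₗ[R'] MvPolynomial σ R' :=
        (basisMonomials σ R').constr R' (fun a => map k (π (monomial a 1)))
      have hm1 : ∀ a, π' (monomial a 1) = map k (π (monomial a 1)) := by
        intro a
        have := (basisMonomials σ R').constr_basis R' (fun a => map k (π (monomial a 1))) a
        rwa [coe_basisMonomials] at this
      have hmr : ∀ {S : Type _} [CommRing S] (a : σ →₀ ℕ) (r : S),
          (monomial a r : MvPolynomial σ S) = r • monomial a 1 := by
        intro S _ a r
        rw [smul_monomial, smul_eq_mul, mul_one]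
      have hmap : ∀ h, π' (map k h) = map k (π h) := by
        intro h
        induction h using MvPolynomial.induction_on' with
        | monomial a r =>
          rw [map_monomial, hmr, map_smul, hm1, hmr a r, map_smul, smul_eq_C_mul, smul_eq_C_mul,
            map_mul, map_C]
        | add f g hf hg => simp only [map_add, hf, hg]
      refine ⟨π', ?_, ?_⟩
      · intro h
        induction h using MvPolynomial.induction_on' with
        | monomial a r =>
          rw [hmr, map_smul, hm1, smul_eq_C_mul, ← hI]
          exact Ideal.mul_mem_left _ _ (Ideal.mem_map_of_mem _ (h1 _))
        | add f g hf hg => rw [map_add]; exact Ideal.add_mem _ hf hg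
      · intro h hh
        rw [← hI] at hh
        suffices ∀ a, π' (a * h) = weightedHomogeneousComponent (fun k => p ^ d k) (p ^ l) (a * h) by
          simpa using this 1
        refine Submodule.span_induction ?_ ?_ ?_ ?_ (show h ∈ Submodule.span _ _ from hh)
        · rintro _ ⟨f, hf, rfl⟩ a
          induction a using MvPolynomial.induction_on' with
          | monomial a r =>
            have : (monomial a r : MvPolynomial σ R') * map k f = r • map k (monomial a 1 * f) := by
              rw [map_mul, map_monomial, map_one, ← smul_mul_assoc, ← hmr]
            rw [this, map_smul, map_smul, hmap, comp_map, h2 _ (Ideal.mul_mem_left _ _ hf)]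
          | add f g hf hg => rw [add_mul, map_add, map_add, hf, hg]
        · intro a; simp
        · intro f g _ _ hf hg a
          rw [mul_add, map_add, map_add, hf, hg]
        · intro b f _ hf a
          rw [smul_eq_mul, ← mul_assoc]; exact hf _
  rw [← hI] at key
  have := flat_baseChange (R := R) (R' := R') (Id p d s)
  have : Module.Flat R R' := IsLocalization.flat R' P.primeCompl
  exact Module.Flat.trans R R' _

lemma exists_phi {p : ℕ} {R : Type*} [CommRing R] {mv : ℕ} {d : Fin mv → ℕ} {l : ℕ}
    {f : MvPolynomial (Fin mv) R} (hf : f ∈ FPV p R mv d l) :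
    ∃ v : Fin mv → R, (∀ i, l < d i → v i = 0) ∧ phi p d l v = f := by
  refine Submodule.span_induction ?_ ?_ ?_ ?_ (show f ∈ Submodule.span _ _ from hf)
  · rintro _ ⟨i, hi, rfl⟩
    refine ⟨Pi.single i 1, ?_, ?_⟩
    · intro k hk
      rw [Pi.single_eq_of_ne]
      rintro rfl
      omega
    · unfold phi
      rw [Finset.sum_eq_single i]
      · simp
      · intro k _ hk
        simp [Pi.single_eq_of_ne hk]
      · simp
  · exact ⟨0, by simp, phi_zero _⟩
  · rintro _ _ _ _ ⟨u, hu, rfl⟩ ⟨v, hv, rfl⟩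
    exact ⟨u + v, fun i hi => by simp [hu i hi, hv i hi], phi_add _ _ _⟩
  · rintro c _ _ ⟨u, hu, rfl⟩
    exact ⟨c • u, fun i hi => by simp [hu i hi], by rw [phi_smul, smul_eq_C_mul]⟩

end TwLin

/-- Let `I ⊆ R[𝔛]` be a twisted-linear ideal generated by twisted-linear elements of degree
`≤ p^n` (i.e. lying in `FPV_l(R)` with `l ≤ n`). If the homogeneous components
`(R[𝔛]/I)_{p^i}` are `R`-flat for `i = 0, 1, …, n`, then `R[𝔛]/I` is `R`-flat. -/
theorem flat_of_pPower_components_flat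
    (p : ℕ) (hp : p.Prime) (R : Type*) [CommRing R] [CharP R p]
    (mv : ℕ) (d : Fin mv → ℕ) (n : ℕ) (I : Ideal (MvPolynomial (Fin mv) R))
    (htl : ∃ s : Finset (MvPolynomial (Fin mv) R),
      (∀ f ∈ s, ∃ l : ℕ, l ≤ n ∧ f ∈ FPV p R mv d l) ∧ I = Ideal.span s)
    (hcomp : ∀ i : ℕ, i ≤ n →
      Module.Flat R
        (↥(weightedHomogeneousSubmodule R (fun k => p ^ d k) (p ^ i)) ⧸
          Submodule.comap (weightedHomogeneousSubmodule R (fun k => p ^ d k) (p ^ i)).subtype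
            (I.restrictScalars R))) :
    Module.Flat R (MvPolynomial (Fin mv) R ⧸ I) := by

  obtain ⟨s, hs, rfl⟩ := htl
  have h : ∀ f : s, ∃ x : ℕ × (Fin mv → R), x.1 ≤ n ∧ (∀ i, x.1 < d i → x.2 i = 0) ∧
      TwLin.phi p d x.1 x.2 = f := by
    intro f
    obtain ⟨l, hl, hf⟩ := hs f f.2
    obtain ⟨v, hv, hv'⟩ := TwLin.exists_phi hf
    exact ⟨(l, v), hl, hv, hv'⟩
  choose x hx1 hx2 hx3 using h
  have hI : Ideal.span (s : Set (MvPolynomial (Fin mv) R)) = TwLin.Id p d (Set.range x) := by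
    unfold TwLin.Id
    congr 1
    rw [← Set.range_comp]
    have : ((fun x => TwLin.phi p d x.1 x.2) ∘ x) = (fun f : s => (f : MvPolynomial (Fin mv) R)) :=
      funext hx3
    rw [this]
    simp
  rw [hI] at hcomp ⊢
  have hsupp : ∀ y ∈ Set.range x, ∀ i, y.1 < d i → y.2 i = 0 := by
    rintro _ ⟨f, rfl⟩
    exact hx2 f
  refine TwLin.flat_global hp n (Fin mv) d _ (Set.finite_range x) hsupp ?_ ?_
  · rintro _ ⟨f, rfl⟩
    exact hx1 f
  · intro l hl
    exact TwLin.exists_pi hp (Set.finite_range x) hsupp l (hcomp l hl)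
end
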